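/- Let (G, P, L) be a minimum counterexample to the following statement, minimizing |V(G)| + |E(G)|: 'Every triangle-free plane graph G with outer face F, subpath P ⊆ F with at most two vertices, and (*,1)-list assignment L satisfying conditions (i)–(v) is L-colorable.' Then G has a good vertex, i.e., an L3-vertex on the outer cycle F that lies in no bad 2-chord of F. -/

import Mathlib

open Set

namespace ChoosSep

/-- `G` has a cycle of length `n`. -/
def HasCycleLen {V : Type} (G : SimpleGraph V) (n : ℕ) : Prop :=
  ∃ (v : V) (c : G.Walk v v), c.IsCycle ∧ c.length = n

/-- `G` has a proper coloring choosing each color from the list `L v`. -/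
def ColorableWith {V : Type} (G : SimpleGraph V) (L : V → Finset ℕ) : Prop :=
  ∃ φ : V → ℕ, (∀ v, φ v ∈ L v) ∧ ∀ ⦃u v⦄, G.Adj u v → φ u ≠ φ v

/-- `G` is `(k,d)`-choosable: it has an `L`-coloring for every list assignment
giving each vertex at least `k` colors and any two adjacent vertices at most `d`
common colors. -/
def Choosable {V : Type} (G : SimpleGraph V) (k d : ℕ) : Prop :=
  ∀ L : V → Finset ℕ, (∀ v, k ≤ (L v).card) →
    (∀ ⦃u v⦄, G.Adj u v → ((L u) ∩ (L v)).card ≤ d) →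
    ColorableWith G L

/-- The closed straight segment between two points of the plane. -/
def seg (x y : ℝ × ℝ) : Set (ℝ × ℝ) := segment ℝ x y

/-- A straight-line plane embedding of `G`: vertices go to distinct points, edges are
drawn as straight segments, two distinct edges meet only in common endpoints, and no
vertex lies on the drawing of an edge it does not belong to.  By Fáry's theorem a
finite simple graph admits such an embedding iff it is planar. -/
structure PlaneEmb {V : Type} (G : SimpleGraph V) where
  pos : V → ℝ × ℝ
  inj : Function.Injective pos
  edges_meet : ∀ ⦃a b c d : V⦄, G.Adj a b → G.Adj c d → s(a, b) ≠ s(c, d) →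
    seg (pos a) (pos b) ∩ seg (pos c) (pos d) ⊆ ({pos a, pos b} ∩ {pos c, pos d} : Set (ℝ × ℝ))
  vertex_off : ∀ ⦃a b v : V⦄, G.Adj a b → v ≠ a → v ≠ b → pos v ∉ seg (pos a) (pos b)

/-- `G` is planar: it admits a plane embedding. -/
def IsPlanar {V : Type} (G : SimpleGraph V) : Prop := Nonempty (PlaneEmb G)

variable {V : Type} {G : SimpleGraph V}

/-- The drawing of the graph in the plane: all vertex points and all edge segments. -/
def PlaneEmb.drawing (E : PlaneEmb G) : Set (ℝ × ℝ) :=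
  Set.range E.pos ∪ ⋃ (a : V) (b : V) (_ : G.Adj a b), seg (E.pos a) (E.pos b)

/-- A face of the embedding: a connected component of the complement of the drawing. -/
def PlaneEmb.IsFace (E : PlaneEmb G) (C : Set (ℝ × ℝ)) : Prop :=
  ∃ q, q ∉ E.drawing ∧ C = connectedComponentIn E.drawingᶜ q

/-- The outer face: the unbounded face. -/
def PlaneEmb.IsOuterFace (E : PlaneEmb G) (C : Set (ℝ × ℝ)) : Prop :=
  E.IsFace C ∧ ¬ Bornology.IsBounded C

/-- The vertices lying on the boundary of the face `C`. -/
def PlaneEmb.onFace (E : PlaneEmb G) (C : Set (ℝ × ℝ)) : Set V :=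
  {v | E.pos v ∈ closure C}

/-- An edge of `G` lying on the boundary of the face `C`. -/
def PlaneEmb.BoundaryEdge (E : PlaneEmb G) (C : Set (ℝ × ℝ)) (u v : V) : Prop :=
  G.Adj u v ∧ seg (E.pos u) (E.pos v) ⊆ closure C

/-- `C` is a 3-face with (mutually adjacent) incident vertices `x`, `y`, `z`. -/
def PlaneEmb.IsTriFace (E : PlaneEmb G) (C : Set (ℝ × ℝ)) (x y z : V) : Prop :=
  E.IsFace C ∧ G.Adj x y ∧ G.Adj y z ∧ G.Adj x z ∧
    frontier C = seg (E.pos x) (E.pos y) ∪ seg (E.pos y) (E.pos z) ∪ seg (E.pos x) (E.pos z)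

/-- `C` is a 4-face with incident 4-cycle `w x y z`. -/
def PlaneEmb.IsQuadFace (E : PlaneEmb G) (C : Set (ℝ × ℝ)) (w x y z : V) : Prop :=
  E.IsFace C ∧ G.Adj w x ∧ G.Adj x y ∧ G.Adj y z ∧ G.Adj z w ∧ w ≠ y ∧ x ≠ z ∧
    frontier C = seg (E.pos w) (E.pos x) ∪ seg (E.pos x) (E.pos y) ∪
      seg (E.pos y) (E.pos z) ∪ seg (E.pos z) (E.pos w)

/-- `x z1 y z2` is a diamond: a 4-cycle formed by two adjacent 3-faces
`x y z1` and `x y z2` sharing the edge `x y`. -/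
def PlaneEmb.IsDiamond (E : PlaneEmb G) (x z1 y z2 : V) : Prop :=
  z1 ≠ z2 ∧ ∃ C1 C2 : Set (ℝ × ℝ), C1 ≠ C2 ∧ E.IsTriFace C1 x y z1 ∧ E.IsTriFace C2 x y z2

/-- The union of the three sides of the triangle `a b c`. -/
def triBoundary (a b c : ℝ × ℝ) : Set (ℝ × ℝ) := seg a b ∪ seg b c ∪ seg a c

/-- The open interior region of the triangle `a b c`: points off the triangle whose
connected component in the complement of the triangle is bounded. -/
def triInterior (a b c : ℝ × ℝ) : Set (ℝ × ℝ) :=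
  {p | p ∉ triBoundary a b c ∧
    Bornology.IsBounded (connectedComponentIn (triBoundary a b c)ᶜ p)}

/-- The degree of a vertex. -/
noncomputable def deg (G : SimpleGraph V) (v : V) : ℕ := Nat.card {u : V // G.Adj v u}

/-- `G` is 2-connected: connected and with no cutvertex. -/
def TwoConnected (G : SimpleGraph V) : Prop :=
  G.Connected ∧ ∀ v : V, (G.induce {u : V | u ≠ v}).Connected

/-- A configuration for Theorem 5: a triangle-free plane graph with outer face `F`,
a precolored subpath `P` of the outer face with at most two vertices, and a
`(*,1)`-list assignment `L` satisfying conditions (i)–(v). -/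
structure Cfg3 where
  n : ℕ
  G : SimpleGraph (Fin n)
  E : PlaneEmb G
  F : Set (ℝ × ℝ)
  P : List (Fin n)
  L : Fin n → Finset ℕ

namespace Cfg3

/-- All hypotheses of Theorem 5 hold for the configuration. -/
def Valid (C : Cfg3) : Prop :=
  (¬ HasCycleLen C.G 3) ∧
  C.E.IsOuterFace C.F ∧
  C.P.Nodup ∧ C.P.length ≤ 2 ∧
  (∀ v ∈ C.P, v ∈ C.E.onFace C.F) ∧
  C.P.Chain' (C.E.BoundaryEdge C.F) ∧
  (∀ v, 1 ≤ (C.L v).card) ∧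
  (∀ ⦃u v⦄, C.G.Adj u v → ((C.L u) ∩ (C.L v)).card ≤ 1) ∧
  (∀ v, v ∉ C.E.onFace C.F → 3 ≤ (C.L v).card) ∧
  (∀ v ∈ C.E.onFace C.F, v ∉ C.P → 2 ≤ (C.L v).card) ∧
  (∀ v ∈ C.P, (C.L v).card = 1) ∧
  (∀ ⦃u v⦄, C.G.Adj u v → (C.L u).card = 2 → (C.L v).card ≠ 2) ∧
  (∃ φ : Fin C.n → ℕ, (∀ v ∈ C.P, φ v ∈ C.L v) ∧
    ∀ ⦃u v⦄, u ∈ C.P → v ∈ C.P → C.G.Adj u v → φ u ≠ φ v)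

/-- The configuration admits an `L`-coloring. -/
def Colorable (C : Cfg3) : Prop := ColorableWith C.G C.L

/-- The quantity `|V(G)| + |E(G)|`. -/
noncomputable def measure (C : Cfg3) : ℕ := C.n + Nat.card ↥C.G.edgeSet

/-- `C` is a minimum counterexample to Theorem 5: it satisfies the hypotheses, has no
`L`-coloring, and minimizes `|V(G)| + |E(G)|` among all such counterexamples. -/
def MinCounterexample (C : Cfg3) : Prop :=
  C.Valid ∧ ¬ C.Colorable ∧
    ∀ D : Cfg3, D.Valid → ¬ D.Colorable → C.measure ≤ D.measure

/-- `uv` is a chord of the outer cycle: an edge between two vertices of the outer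
face that is not an edge of the outer face. -/
def IsChord (C : Cfg3) (u v : Fin C.n) : Prop :=
  C.G.Adj u v ∧ u ∈ C.E.onFace C.F ∧ v ∈ C.E.onFace C.F ∧ ¬ C.E.BoundaryEdge C.F u v

/-- `v0 v1 v2` is a 2-chord of the outer cycle. -/
def Is2Chord (C : Cfg3) (v0 v1 v2 : Fin C.n) : Prop :=
  C.G.Adj v0 v1 ∧ C.G.Adj v1 v2 ∧ v0 ≠ v2 ∧
    v0 ∈ C.E.onFace C.F ∧ v2 ∈ C.E.onFace C.F ∧ v1 ∉ C.E.onFace C.F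

/-- A 2-chord `v0 v1 v2` is bad if `v0` or `v2` is an `L2`-vertex. -/
def IsBad2Chord (C : Cfg3) (v0 v1 v2 : Fin C.n) : Prop :=
  C.Is2Chord v0 v1 v2 ∧ ((C.L v0).card = 2 ∨ (C.L v2).card = 2)

/-- An `L3`-vertex of the outer face is good if it lies on no bad 2-chord. -/
def IsGoodVertex (C : Cfg3) (x : Fin C.n) : Prop :=
  x ∈ C.E.onFace C.F ∧ (C.L x).card = 3 ∧
    ¬ ∃ v0 v1 v2, C.IsBad2Chord v0 v1 v2 ∧ (x = v0 ∨ x = v1 ∨ x = v2)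

end Cfg3

/-- A straight-line drawing in `ℂ` of a finite set of oriented edges. -/
structure LineDrawing (V : Type) where
  pos : V → ℂ
  edges : Finset (V × V)
  inj : Function.Injective pos
  ne : ∀ e ∈ edges, e.1 ≠ e.2
  meet : ∀ e ∈ edges, ∀ f ∈ edges, e ≠ f →
    segment ℝ (pos e.1) (pos e.2) ∩ segment ℝ (pos f.1) (pos f.2) ⊆
      ({pos e.1, pos e.2} ∩ {pos f.1, pos f.2} : Set ℂ)
  off : ∀ e ∈ edges, ∀ v, v ≠ e.1 → v ≠ e.2 → pos v ∉ segment ℝ (pos e.1) (pos e.2)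

namespace LineDrawing

variable {V : Type} (D : LineDrawing V)

/-- The affine coordinate sending the tail of `e` to `0` and its head to `1`. -/
noncomputable def coord (e : V × V) (q : ℂ) : ℂ :=
  (q - D.pos e.1) / (D.pos e.2 - D.pos e.1)

/-- The inverse of `coord`. -/
noncomputable def point (e : V × V) (t : ℂ) : ℂ :=
  D.pos e.1 + t * (D.pos e.2 - D.pos e.1)

/-- The closed segment representing `e`. -/
def arc (e : V × V) : Set ℂ := segment ℝ (D.pos e.1) (D.pos e.2)

/-- The edge `e` without its endpoints. -/
def openArc (e : V × V) : Set ℂ :=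
  {q | (D.coord e q).im = 0 ∧ 0 < (D.coord e q).re ∧ (D.coord e q).re < 1}

/-- The union of all the edges. -/
def carrier : Set ℂ := ⋃ e ∈ D.edges, D.arc e

/-- The component of the complement of the drawing containing `q`. -/
def region (q : ℂ) : Set ℂ := connectedComponentIn D.carrierᶜ q

variable {D}

lemma sub_ne_zero_of_mem {e : V × V} (he : e ∈ D.edges) : D.pos e.2 - D.pos e.1 ≠ 0 :=
  sub_ne_zero.2 fun h => D.ne e he (D.inj h).symm

lemma coord_point {e : V × V} (he : e ∈ D.edges) (t : ℂ) : D.coord e (D.point e t) = t := by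
  have := sub_ne_zero_of_mem he
  simp [coord, point, this]

lemma point_coord {e : V × V} (he : e ∈ D.edges) (q : ℂ) : D.point e (D.coord e q) = q := by
  have := sub_ne_zero_of_mem he
  simp [coord, point, this]

lemma continuous_coord (e : V × V) : Continuous (D.coord e) := by
  unfold coord; fun_prop

lemma continuous_point (e : V × V) : Continuous (D.point e) := by
  unfold point; fun_prop

lemma mem_arc_iff {e : V × V} (he : e ∈ D.edges) {q : ℂ} :
    q ∈ D.arc e ↔ (D.coord e q).im = 0 ∧ 0 ≤ (D.coord e q).re ∧ (D.coord e q).re ≤ 1 := by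
  rw [arc, segment_eq_image']
  constructor
  · rintro ⟨t, ⟨h0, h1⟩, rfl⟩
    have : D.coord e (D.pos e.1 + t • (D.pos e.2 - D.pos e.1)) = (t : ℂ) :=
      coord_point he t
    rw [this]
    simp [h0, h1]
  · rintro ⟨h, h0, h1⟩
    refine ⟨_, ⟨h0, h1⟩, ?_⟩
    have h2 : (((D.coord e q).re : ℝ) : ℂ) = D.coord e q := by
      apply Complex.ext <;> simp [h]
    have := point_coord he q
    rw [← h2] at this
    simpa [point] using this

lemma openArc_subset_arc {e : V × V} (he : e ∈ D.edges) : D.openArc e ⊆ D.arc e := by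
  rintro q ⟨h, h0, h1⟩
  exact (mem_arc_iff he).2 ⟨h, h0.le, h1.le⟩

lemma point_mem_openArc {e : V × V} (he : e ∈ D.edges) {t : ℝ} (h0 : 0 < t) (h1 : t < 1) :
    D.point e t ∈ D.openArc e := by
  simp [openArc, coord_point he, h0, h1]

lemma arc_subset_carrier {e : V × V} (he : e ∈ D.edges) : D.arc e ⊆ D.carrier :=
  subset_biUnion_of_mem (u := fun e => D.arc e) (by exact he)

lemma mem_carrier {q : ℂ} : q ∈ D.carrier ↔ ∃ e ∈ D.edges, q ∈ D.arc e := by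
  simp [carrier]

lemma coord_fst (e : V × V) : D.coord e (D.pos e.1) = 0 := by simp [coord]

lemma coord_snd {e : V × V} (he : e ∈ D.edges) : D.coord e (D.pos e.2) = 1 :=
  div_self (sub_ne_zero_of_mem he)

lemma pos_notMem_openArc {e : V × V} (he : e ∈ D.edges) (v : V) : D.pos v ∉ D.openArc e := by
  intro h
  by_cases h1 : v = e.1
  · subst h1
    simp [openArc, coord_fst] at h
  by_cases h2 : v = e.2
  · subst h2
    simp [openArc, coord_snd he] at h
  exact D.off e he v h1 h2 (openArc_subset_arc he h)

lemma eq_of_mem_openArc_of_mem_arc {e f : V × V} (he : e ∈ D.edges) (hf : f ∈ D.edges) {q : ℂ}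
    (h : q ∈ D.openArc e) (h' : q ∈ D.arc f) : e = f := by
  by_contra hne
  have := (D.meet e he f hf hne ⟨openArc_subset_arc he h, h'⟩).1
  rcases this with rfl | rfl
  · exact pos_notMem_openArc he _ h
  · exact pos_notMem_openArc he _ h

lemma mem_openArc_of_mem_arc {e : V × V} (he : e ∈ D.edges) {q : ℂ} (h : q ∈ D.arc e)
    (h1 : q ≠ D.pos e.1) (h2 : q ≠ D.pos e.2) : q ∈ D.openArc e := by
  obtain ⟨hi, h0, h1'⟩ := (mem_arc_iff he).1 h
  refine ⟨hi, lt_of_le_of_ne h0 fun h3 => h1 ?_, lt_of_le_of_ne h1' fun h3 => h2 ?_⟩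
  · rw [← point_coord he q, show D.coord e q = 0 from Complex.ext h3.symm hi]
    simp [point]
  · rw [← point_coord he q, show D.coord e q = 1 from Complex.ext h3 hi]
    simp [point]

lemma isCompact_segment (x y : ℂ) : IsCompact (segment ℝ x y) := by
  rw [segment_eq_image']
  exact isCompact_Icc.image (by fun_prop)

lemma isCompact_arc (e : V × V) : IsCompact (D.arc e) :=
  isCompact_segment _ _

lemma isClosed_carrier : IsClosed D.carrier :=
  D.edges.finite_toSet.isClosed_biUnion fun e _ => (isCompact_arc e).isClosed

lemma region_eq_of_preconnected {T : Set ℂ} (hT : IsPreconnected T) (h : T ⊆ D.carrierᶜ)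
    {x y : ℂ} (hx : x ∈ T) (hy : y ∈ T) : D.region x = D.region y :=
  connectedComponentIn_eq (hT.subset_connectedComponentIn hx h hy)

lemma eventually_region_eq {q : ℂ} (hq : q ∉ D.carrier) :
    ∀ᶠ x in nhds q, x ∉ D.carrier ∧ D.region x = D.region q := by
  have ho : IsOpen (D.region q) := isClosed_carrier.isOpen_compl.connectedComponentIn
  filter_upwards [ho.mem_nhds (mem_connectedComponentIn hq)] with x hx
  exact ⟨connectedComponentIn_subset _ _ hx, (connectedComponentIn_eq hx).symm⟩

lemma coord_convex_comb (e : V × V) {a b : ℝ} (hab : a + b = 1) (x y : ℂ) :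
    D.coord e (a • x + b • y) = a • D.coord e x + b • D.coord e y := by
  have h1 : (a : ℂ) + b = 1 := by exact_mod_cast hab
  simp only [coord, Complex.real_smul, div_eq_mul_inv]
  linear_combination (D.pos e.1 * (D.pos e.2 - D.pos e.1)⁻¹) * h1

/-- Near two interior points of an edge, the points on the same side of the edge (described by a
convex set `K`) all lie in a common region. -/
lemma exists_region_near_pair {e : V × V} (he : e ∈ D.edges) {K : Set ℂ} (hK : Convex ℝ K)
    (hd : Disjoint K (D.arc e)) {p m : ℂ} (hp : p ∈ D.openArc e) (hm : m ∈ D.openArc e) :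
    ∃ X, (∀ᶠ q in nhds p, q ∈ K → q ∉ D.carrier ∧ D.region q = X) ∧
      ∀ᶠ q in nhds m, q ∈ K → q ∉ D.carrier ∧ D.region q = X := by
  set R : Set ℂ := ⋃ f ∈ (D.edges : Set (V × V)) \ {e}, D.arc f
  have hR : IsClosed R :=
    D.edges.finite_toSet.sdiff.isClosed_biUnion fun f _ => (isCompact_arc f).isClosed
  have hseg : segment ℝ p m ⊆ D.openArc e := by
    intro q hq
    obtain ⟨a, b, ha, hb, hab, rfl⟩ := hq
    have hc := coord_convex_comb (D := D) e hab p m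
    obtain ⟨h1, h2, h3⟩ := hp
    obtain ⟨h4, h5, h6⟩ := hm
    rw [openArc, mem_ofPred_eq, hc]
    simp only [Complex.add_im, Complex.add_re, Complex.smul_im, Complex.smul_re, smul_eq_mul, h1,
      h4]
    refine ⟨by simp, ?_, ?_⟩
    · rcases ha.eq_or_lt with rfl | ha
      · have : b = 1 := by linarith
        subst this; linarith
      · have := mul_pos ha h2
        have := mul_nonneg hb h5.le
        linarith
    · rcases ha.eq_or_lt with rfl | ha
      · have : b = 1 := by linarith
        subst this; linarith
      · have := mul_lt_mul_of_pos_left h3 ha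
        have := mul_le_mul_of_nonneg_left h6.le hb
        linarith
  have hdis : Disjoint (segment ℝ p m) R := by
    rw [Set.disjoint_left]
    intro q hq hqR
    simp only [R, mem_iUnion] at hqR
    obtain ⟨f, ⟨hf, hne⟩, hqf⟩ := hqR
    exact hne (eq_of_mem_openArc_of_mem_arc he hf (hseg hq) hqf).symm
  obtain ⟨δ, hδ, hdδ⟩ := hdis.exists_thickenings (isCompact_segment p m) hR
  set T := Metric.thickening δ (segment ℝ p m) ∩ K
  have hTc : IsPreconnected T := (((convex_segment p m).thickening δ).inter hK).isPreconnected
  have hTD : T ⊆ D.carrierᶜ := by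
    rintro q ⟨hq, hqK⟩ hqD
    obtain ⟨f, hf, hqf⟩ := mem_carrier.1 hqD
    by_cases hfe : f = e
    · subst hfe
      exact Set.disjoint_left.1 hd hqK hqf
    · refine Set.disjoint_left.1 hdδ hq (Metric.self_subset_thickening hδ _ ?_)
      exact mem_biUnion (show f ∈ (D.edges : Set (V × V)) \ {e} from ⟨hf, hfe⟩) hqf
  obtain ⟨X, hX⟩ : ∃ X, ∀ q ∈ T, D.region q = X := by
    by_cases hne : T.Nonempty
    · obtain ⟨x, hx⟩ := hne
      exact ⟨D.region x, fun q hq => region_eq_of_preconnected hTc hTD hq hx⟩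
    · exact ⟨∅, fun q hq => (hne ⟨q, hq⟩).elim⟩
  have key : ∀ x ∈ segment ℝ p m, ∀ᶠ q in nhds x, q ∈ K → q ∉ D.carrier ∧ D.region q = X := by
    intro x hx
    filter_upwards [Metric.isOpen_thickening.mem_nhds (Metric.self_subset_thickening hδ _ hx)]
      with q hq hqK
    exact ⟨hTD ⟨hq, hqK⟩, hX q ⟨hq, hqK⟩⟩
  exact ⟨X, key p (left_mem_segment ..), key m (right_mem_segment ..)⟩

/-- All points close to the edge `e` and inside `K` lie in a common region. -/
lemma exists_region_near {e : V × V} (he : e ∈ D.edges) {K : Set ℂ} (hK : Convex ℝ K)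
    (hd : Disjoint K (D.arc e)) (hcl : ∃ m ∈ D.openArc e, m ∈ closure K) :
    ∃ X, ∀ p ∈ D.openArc e, ∀ᶠ q in nhds p, q ∈ K → q ∉ D.carrier ∧ D.region q = X := by
  obtain ⟨m, hm, hmK⟩ := hcl
  obtain ⟨X, hX, -⟩ := exists_region_near_pair he hK hd hm hm
  refine ⟨X, fun p hp => ?_⟩
  obtain ⟨Y, hY, hY'⟩ := exists_region_near_pair he hK hd hp hm
  obtain ⟨q, hq, h1, h2⟩ :=
    ((mem_closure_iff_frequently.1 hmK).and_eventually (hX.and hY')).exists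
  rwa [show X = Y from (h1 hq).2.symm.trans (h2 hq).2]

lemma convex_im_pos (e : V × V) : Convex ℝ {q | 0 < (D.coord e q).im} := by
  intro x hx y hy a b ha hb hab
  rw [mem_ofPred_eq, coord_convex_comb e hab]
  exact (convex_halfSpace_im_gt 0) hx hy ha hb hab

lemma convex_im_neg (e : V × V) : Convex ℝ {q | (D.coord e q).im < 0} := by
  intro x hx y hy a b ha hb hab
  rw [mem_ofPred_eq, coord_convex_comb e hab]
  exact (convex_halfSpace_im_lt 0) hx hy ha hb hab

/-- The points near the edge `e` lie in the region `X.1` to its left and `X.2` to its right. -/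
def AreSides (D : LineDrawing V) (e : V × V) (X : Set ℂ × Set ℂ) : Prop :=
  ∀ p ∈ D.openArc e, ∀ᶠ q in nhds p,
    (0 < (D.coord e q).im → q ∉ D.carrier ∧ D.region q = X.1) ∧
    ((D.coord e q).im < 0 → q ∉ D.carrier ∧ D.region q = X.2)

lemma tendsto_point_add (e : V × V) (t s : ℂ) :
    Filter.Tendsto (fun ε : ℝ => D.point e (t + s * ε)) (nhdsWithin 0 (Ioi 0))
      (nhds (D.point e t)) := by
  have h : Continuous fun ε : ℝ => D.point e (t + s * ε) :=
    (continuous_point e).comp (by fun_prop)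
  simpa using (h.tendsto 0).mono_left nhdsWithin_le_nhds

lemma exists_areSides {e : V × V} (he : e ∈ D.edges) : ∃ X, D.AreSides e X := by
  have hm : D.point e ((1 / 2 : ℝ) : ℂ) ∈ D.openArc e :=
    point_mem_openArc he (by norm_num) (by norm_num)
  obtain ⟨X, hX⟩ := exists_region_near he (convex_im_pos e)
    (Set.disjoint_left.2 fun q hq hq' => hq.ne' ((mem_arc_iff he).1 hq').1)
    ⟨_, hm, mem_closure_of_tendsto (tendsto_point_add e _ Complex.I) (by
      filter_upwards [self_mem_nhdsWithin] with ε hε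
      simpa [coord_point he] using hε)⟩
  obtain ⟨Y, hY⟩ := exists_region_near he (convex_im_neg e)
    (Set.disjoint_left.2 fun q hq hq' => hq.ne ((mem_arc_iff he).1 hq').1)
    ⟨_, hm, mem_closure_of_tendsto (tendsto_point_add e _ (-Complex.I)) (by
      filter_upwards [self_mem_nhdsWithin] with ε hε
      simpa [coord_point he] using hε)⟩
  exact ⟨(X, Y), fun p hp => (hX p hp).and (hY p hp)⟩

/-- The regions to the left and to the right of an edge. -/
noncomputable def sides (D : LineDrawing V) (e : V × V) : Set ℂ × Set ℂ :=
  Classical.epsilon (D.AreSides e)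

/-- The region to the left of an edge. -/
noncomputable def left (D : LineDrawing V) (e : V × V) : Set ℂ := (D.sides e).1

/-- The region to the right of an edge. -/
noncomputable def right (D : LineDrawing V) (e : V × V) : Set ℂ := (D.sides e).2

lemma eventually_sides {e : V × V} (he : e ∈ D.edges) {p : ℂ} (hp : p ∈ D.openArc e) :
    ∀ᶠ q in nhds p, (0 < (D.coord e q).im → q ∉ D.carrier ∧ D.region q = D.left e) ∧
      ((D.coord e q).im < 0 → q ∉ D.carrier ∧ D.region q = D.right e) :=
  Classical.epsilon_spec (exists_areSides he) p hp

lemma eventually_openArc {e : V × V} {p : ℂ} (hp : p ∈ D.openArc e) :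
    ∀ᶠ q in nhds p, (D.coord e q).im = 0 → q ∈ D.openArc e := by
  have hc : Continuous fun q => (D.coord e q).re :=
    Complex.continuous_re.comp (continuous_coord e)
  filter_upwards [(isOpen_lt continuous_const hc).mem_nhds hp.2.1,
    (isOpen_lt hc continuous_const).mem_nhds hp.2.2] with q h1 h2 h3
  exact ⟨h3, h1, h2⟩

/-- `q` lies in the region `X` or inside an edge with both sides in `X`. -/
def Near (D : LineDrawing V) (X : Set ℂ) (q : ℂ) : Prop :=
  (q ∉ D.carrier ∧ D.region q = X) ∨
    ∃ e ∈ D.edges, q ∈ D.openArc e ∧ D.left e = X ∧ D.right e = X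

/-- `q` lies in a region other than `X` or inside an edge with no side in `X`. -/
def Far (D : LineDrawing V) (X : Set ℂ) (q : ℂ) : Prop :=
  (q ∉ D.carrier ∧ D.region q ≠ X) ∨
    ∃ e ∈ D.edges, q ∈ D.openArc e ∧ D.left e ≠ X ∧ D.right e ≠ X

lemma isOpen_near (X : Set ℂ) : IsOpen {q | D.Near X q} := by
  rw [isOpen_iff_mem_nhds]
  rintro q (⟨hq, rfl⟩ | ⟨e, he, hq, hl, hr⟩)
  · filter_upwards [eventually_region_eq hq] with x hx using Or.inl hx
  · filter_upwards [eventually_sides he hq, eventually_openArc hq] with x hx hx'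
    rcases lt_trichotomy (D.coord e x).im 0 with h | h | h
    · exact Or.inl (hr ▸ hx.2 h)
    · exact Or.inr ⟨e, he, hx' h, hl, hr⟩
    · exact Or.inl (hl ▸ hx.1 h)

lemma isOpen_far (X : Set ℂ) : IsOpen {q | D.Far X q} := by
  rw [isOpen_iff_mem_nhds]
  rintro q (⟨hq, hX⟩ | ⟨e, he, hq, hl, hr⟩)
  · filter_upwards [eventually_region_eq hq] with x hx using Or.inl ⟨hx.1, hx.2 ▸ hX⟩
  · filter_upwards [eventually_sides he hq, eventually_openArc hq] with x hx hx'
    rcases lt_trichotomy (D.coord e x).im 0 with h | h | h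
    · exact Or.inl ⟨(hx.2 h).1, (hx.2 h).2 ▸ hr⟩
    · exact Or.inr ⟨e, he, hx' h, hl, hr⟩
    · exact Or.inl ⟨(hx.1 h).1, (hx.1 h).2 ▸ hl⟩

lemma not_far_of_near {X : Set ℂ} {q : ℂ} (h : D.Near X q) : ¬ D.Far X q := by
  have hoc : ∀ e ∈ D.edges, q ∈ D.openArc e → q ∈ D.carrier := fun e he hq =>
    arc_subset_carrier he (openArc_subset_arc he hq)
  rintro (⟨h1, h2⟩ | ⟨e, he, h1, h2, -⟩) <;> rcases h with ⟨h3, h4⟩ | ⟨f, hf, h3, h4, -⟩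
  · exact h2 h4
  · exact h1 (hoc f hf h3)
  · exact h3 (hoc e he h1)
  · rw [eq_of_mem_openArc_of_mem_arc he hf h1 (openArc_subset_arc hf h3)] at h2
    exact h2 h4

/-- Along a preconnected set avoiding the vertices and the edges with exactly one side in `X`,
one stays in `X`. -/
lemma near_of_isPreconnected {X U : Set ℂ} (hU : IsPreconnected U)
    (hv : ∀ e ∈ D.edges, D.pos e.1 ∉ U ∧ D.pos e.2 ∉ U)
    (hUe : ∀ e ∈ D.edges, (D.openArc e ∩ U).Nonempty → (D.left e = X ↔ D.right e = X))
    {x y : ℂ} (hx : x ∈ U) (hxX : D.Near X x) (hy : y ∈ U) : D.Near X y := by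
  have hcov : U ⊆ {q | D.Near X q} ∪ {q | D.Far X q} := by
    intro q hq
    by_cases hqD : q ∈ D.carrier
    · obtain ⟨e, he, hqe⟩ := mem_carrier.1 hqD
      have hqo : q ∈ D.openArc e := mem_openArc_of_mem_arc he hqe
        (fun h => (hv e he).1 (h ▸ hq)) (fun h => (hv e he).2 (h ▸ hq))
      have hiff := hUe e he ⟨q, hqo, hq⟩
      by_cases hl : D.left e = X
      · exact Or.inl (Or.inr ⟨e, he, hqo, hl, hiff.1 hl⟩)
      · exact Or.inr (Or.inr ⟨e, he, hqo, hl, fun h => hl (hiff.2 h)⟩)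
    · by_cases h : D.region q = X
      · exact Or.inl (Or.inl ⟨hqD, h⟩)
      · exact Or.inr (Or.inl ⟨hqD, h⟩)
  have hdisj : U ∩ ({q | D.Near X q} ∩ {q | D.Far X q}) = ∅ :=
    eq_empty_of_forall_notMem fun q hq => not_far_of_near hq.2.1 hq.2.2
  rcases isPreconnected_iff_subset_of_disjoint.1 hU _ _ (isOpen_near X) (isOpen_far X) hcov hdisj
    with h | h
  · exact h hy
  · exact (not_far_of_near hxX (h hx)).elim

lemma region_eq_of_near {X : Set ℂ} {q : ℂ} (h : D.Near X q) (hq : q ∉ D.carrier) :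
    D.region q = X := by
  rcases h with h | ⟨e, he, h, -⟩
  · exact h.2
  · exact (hq (arc_subset_carrier he (openArc_subset_arc he h))).elim

lemma sides_eq_of_near {X : Set ℂ} {q : ℂ} {e : V × V} (he : e ∈ D.edges) (h : D.Near X q)
    (hq : q ∈ D.openArc e) : D.left e = X ∧ D.right e = X := by
  rcases h with h | ⟨f, hf, h, h'⟩
  · exact (h.1 (arc_subset_carrier he (openArc_subset_arc he hq))).elim
  · rwa [eq_of_mem_openArc_of_mem_arc he hf hq (openArc_subset_arc hf h)]

lemma eventually_im_pos {e : V × V} (he : e ∈ D.edges) (t : ℝ) :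
    ∀ᶠ ε : ℝ in nhdsWithin 0 (Ioi 0), 0 < (D.coord e (D.point e (t + Complex.I * ε))).im := by
  filter_upwards [self_mem_nhdsWithin] with ε hε
  simpa [coord_point he] using hε

lemma eventually_im_neg {e : V × V} (he : e ∈ D.edges) (t : ℝ) :
    ∀ᶠ ε : ℝ in nhdsWithin 0 (Ioi 0), (D.coord e (D.point e (t + -Complex.I * ε))).im < 0 := by
  filter_upwards [self_mem_nhdsWithin] with ε hε
  simpa [coord_point he] using hε

lemma eventually_left {e : V × V} (he : e ∈ D.edges) {t : ℝ} (h0 : 0 < t) (h1 : t < 1) :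
    ∀ᶠ ε : ℝ in nhdsWithin 0 (Ioi 0), D.point e (t + Complex.I * ε) ∉ D.carrier ∧
      D.region (D.point e (t + Complex.I * ε)) = D.left e := by
  filter_upwards [(tendsto_point_add e t Complex.I).eventually
    (eventually_sides he (point_mem_openArc he h0 h1)), eventually_im_pos he t] with ε h2 h3
  exact h2.1 h3

lemma eventually_right {e : V × V} (he : e ∈ D.edges) {t : ℝ} (h0 : 0 < t) (h1 : t < 1) :
    ∀ᶠ ε : ℝ in nhdsWithin 0 (Ioi 0), D.point e (t + -Complex.I * ε) ∉ D.carrier ∧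
      D.region (D.point e (t + -Complex.I * ε)) = D.right e := by
  filter_upwards [(tendsto_point_add e t (-Complex.I)).eventually
    (eventually_sides he (point_mem_openArc he h0 h1)), eventually_im_neg he t] with ε h2 h3
  exact h2.2 h3

/-- The edge `e` has exactly one side in `X`. -/
def Bounds (D : LineDrawing V) (X : Set ℂ) (e : V × V) : Prop :=
  ¬ (D.left e = X ↔ D.right e = X)

/-- The vertex `v` is an endpoint of the edge `e`. -/
def Inc (v : V) (e : V × V) : Prop := v = e.1 ∨ v = e.2

/-- A small ball around a vertex meets only the edges at that vertex. -/
lemma exists_ball (D : LineDrawing V) (v : V) : ∃ δ > 0,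
    (∀ e ∈ D.edges, ¬ Inc v e → Disjoint (Metric.ball (D.pos v) δ) (D.arc e)) ∧
    ∀ e ∈ D.edges, ∀ w, Inc w e → w ≠ v → D.pos w ∉ Metric.ball (D.pos v) δ := by
  have h : ∀ᶠ q in nhds (D.pos v),
      (∀ e ∈ D.edges, ¬ Inc v e → q ∉ D.arc e) ∧
      ∀ e ∈ D.edges, (e.1 ≠ v → q ≠ D.pos e.1) ∧ (e.2 ≠ v → q ≠ D.pos e.2) := by
    refine Filter.Eventually.and ?_ ?_
    · rw [Filter.eventually_all_finset]
      intro e he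
      rw [Filter.eventually_imp_distrib_left]
      intro hve
      refine (isCompact_arc e).isClosed.isOpen_compl.mem_nhds ?_
      exact D.off e he v (fun h => hve (Or.inl h)) (fun h => hve (Or.inr h))
    · rw [Filter.eventually_all_finset]
      intro e he
      refine Filter.Eventually.and ?_ ?_
      · rw [Filter.eventually_imp_distrib_left]
        exact fun h => isOpen_ne.mem_nhds fun h' => h (D.inj h').symm
      · rw [Filter.eventually_imp_distrib_left]
        exact fun h => isOpen_ne.mem_nhds fun h' => h (D.inj h').symm
  obtain ⟨δ, hδ, hb⟩ := Metric.eventually_nhds_iff_ball.1 h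
  refine ⟨δ, hδ, fun e he hve => Set.disjoint_left.2 fun q hq => (hb q hq).1 e he hve, ?_⟩
  rintro e he w (rfl | rfl) hw hmem
  · exact ((hb _ hmem).2 e he).1 hw rfl
  · exact ((hb _ hmem).2 e he).2 hw rfl

lemma isPreconnected_slit_ball {r : ℝ} :
    IsPreconnected (Metric.ball (0 : ℂ) r ∩ Complex.slitPlane) := by
  rcases le_or_gt r 0 with hr | hr
  · simpa [Metric.ball_eq_empty.2 hr] using isPreconnected_empty
  have hc : ((r / 2 : ℝ) : ℂ) ∈ Metric.ball (0 : ℂ) r := by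
    simp [abs_of_pos hr, hr]
  have hs : StarConvex ℝ ((r / 2 : ℝ) : ℂ) (Metric.ball (0 : ℂ) r ∩ Complex.slitPlane) :=
    ((convex_ball _ _).starConvex hc).inter (Complex.starConvex_ofReal_slitPlane (half_pos hr))
  exact (hs.isPathConnected ⟨hc, Or.inl (by simpa using hr)⟩).isConnected.isPreconnected

lemma isPreconnected_punctured_ball {r : ℝ} : IsPreconnected (Metric.ball (0 : ℂ) r \ {0}) := by
  rcases le_or_gt r 0 with hr | hr
  · simpa [Metric.ball_eq_empty.2 hr] using isPreconnected_empty
  have h2 : IsPreconnected ((fun z : ℂ => -z) '' (Metric.ball (0 : ℂ) r ∩ Complex.slitPlane)) :=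
    isPreconnected_slit_ball.image _ continuous_neg.continuousOn
  have hI : Complex.I * ((r / 2 : ℝ) : ℂ) ∈ Metric.ball (0 : ℂ) r ∩ Complex.slitPlane :=
    ⟨by simp [abs_of_pos hr, hr], Or.inr (by simp [hr.ne'])⟩
  have hI' : Complex.I * ((r / 2 : ℝ) : ℂ) ∈
      (fun z : ℂ => -z) '' (Metric.ball (0 : ℂ) r ∩ Complex.slitPlane) :=
    ⟨-(Complex.I * ((r / 2 : ℝ) : ℂ)), ⟨by simp [abs_of_pos hr, hr], Or.inr (by simp [hr.ne'])⟩,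
      by simp⟩
  convert isPreconnected_slit_ball.union _ hI hI' h2 using 1
  ext z
  constructor
  · rintro ⟨hz, hz0⟩
    by_cases hs : z ∈ Complex.slitPlane
    · exact Or.inl ⟨hz, hs⟩
    · refine Or.inr ⟨-z, ⟨by simpa using hz, ?_⟩, by simp⟩
      rw [Complex.mem_slitPlane_iff] at hs ⊢
      push Not at hs
      refine Or.inl (lt_of_le_of_ne (by simpa using hs.1) fun h => hz0 ?_)
      exact Complex.ext (by simpa using h.symm) hs.2
  · rintro (⟨hz, hs⟩ | ⟨w, ⟨hw, hs⟩, rfl⟩)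
    · exact ⟨hz, Complex.slitPlane_ne_zero hs⟩
    · exact ⟨by simpa using hw, by simpa using Complex.slitPlane_ne_zero hs⟩

lemma ball_eq_image {x c : ℂ} (hc : c ≠ 0) (δ : ℝ) (S : Set ℂ) :
    {q ∈ Metric.ball x δ | (q - x) / c ∈ S} =
      (fun z => x + z * c) '' (Metric.ball 0 (δ / ‖c‖) ∩ S) := by
  have hc' : 0 < ‖c‖ := norm_pos_iff.2 hc
  ext q
  constructor
  · rintro ⟨hq, hS⟩
    refine ⟨(q - x) / c, ⟨?_, hS⟩, by field_simp; ring⟩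
    rw [mem_ball_zero_iff, norm_div]
    rw [mem_ball_iff_norm] at hq
    gcongr
  · rintro ⟨z, ⟨hz, hS⟩, rfl⟩
    rw [mem_ball_zero_iff, lt_div_iff₀ hc'] at hz
    refine ⟨by simpa [mem_ball_iff_norm] using hz, by simpa [hc] using hS⟩

lemma isPreconnected_slit {x c : ℂ} (hc : c ≠ 0) (δ : ℝ) :
    IsPreconnected {q ∈ Metric.ball x δ | (q - x) / c ∈ Complex.slitPlane} := by
  rw [ball_eq_image hc]
  exact isPreconnected_slit_ball.image _ (by fun_prop)

lemma isPreconnected_punctured (x : ℂ) (δ : ℝ) :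
    IsPreconnected (Metric.ball x δ \ {x}) := by
  convert (isPreconnected_punctured_ball (r := δ)).image (fun z => x + z) (by fun_prop) using 1
  ext q
  constructor
  · rintro ⟨hq, hx⟩
    exact ⟨q - x, ⟨by simpa [← dist_eq_norm] using hq, by simpa [sub_eq_zero] using hx⟩,
      by simp⟩
  · rintro ⟨z, ⟨hz, h0⟩, rfl⟩
    exact ⟨by simpa using hz, by simpa using h0⟩

lemma not_bounds_of_isPreconnected {e : V × V} (he : e ∈ D.edges) {X U : Set ℂ}
    (hU : IsPreconnected U) (hv : ∀ e ∈ D.edges, D.pos e.1 ∉ U ∧ D.pos e.2 ∉ U)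
    (hUe : ∀ f ∈ D.edges, (D.openArc f ∩ U).Nonempty → ¬ D.Bounds X f)
    {t : ℝ} (h0 : 0 < t) (h1 : t < 1)
    (hp : ∀ᶠ ε : ℝ in nhdsWithin 0 (Ioi 0), D.point e (t + Complex.I * ε) ∈ U)
    (hn : ∀ᶠ ε : ℝ in nhdsWithin 0 (Ioi 0), D.point e (t + -Complex.I * ε) ∈ U) :
    ¬ D.Bounds X e := by
  obtain ⟨ε, ⟨hp, hn⟩, ⟨hl, hl'⟩, hr, hr'⟩ :=
    ((hp.and hn).and ((eventually_left he h0 h1).and (eventually_right he h0 h1))).exists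
  have hUe' : ∀ f ∈ D.edges, (D.openArc f ∩ U).Nonempty → (D.left f = X ↔ D.right f = X) :=
    fun f hf h => not_not.1 (hUe f hf h)
  refine not_not.2 ⟨fun h => ?_, fun h => ?_⟩
  · exact hr' ▸ region_eq_of_near
      (near_of_isPreconnected hU hv hUe' hp (Or.inl ⟨hl, hl'.trans h⟩) hn) hr
  · exact hl' ▸ region_eq_of_near
      (near_of_isPreconnected hU hv hUe' hn (Or.inl ⟨hr, hr'.trans h⟩) hp) hl

lemma exists_point_near {e : V × V} {v : V} (hv : Inc v e) {δ : ℝ}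
    (hδ : 0 < δ) : ∃ t : ℝ, 0 < t ∧ t < 1 ∧ D.point e t ∈ Metric.ball (D.pos v) δ := by
  have h : Continuous fun t : ℝ => D.point e t := (continuous_point e).comp (by fun_prop)
  rcases hv with rfl | rfl
  · have hlim : Filter.Tendsto (fun t : ℝ => D.point e t) (nhdsWithin 0 (Ioi 0))
        (nhds (D.pos e.1)) := by
      simpa [point] using (h.tendsto 0).mono_left nhdsWithin_le_nhds
    obtain ⟨t, ht, h0, h1⟩ := ((hlim.eventually (Metric.ball_mem_nhds _ hδ)).and
      (Ioo_mem_nhdsGT (zero_lt_one' ℝ))).exists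
    exact ⟨t, h0, h1, ht⟩
  · have hlim : Filter.Tendsto (fun t : ℝ => D.point e t) (nhdsWithin 1 (Iio 1))
        (nhds (D.pos e.2)) := by
      simpa [point] using (h.tendsto 1).mono_left nhdsWithin_le_nhds
    obtain ⟨t, ht, h0, h1⟩ := ((hlim.eventually (Metric.ball_mem_nhds _ hδ)).and
      (Ioo_mem_nhdsLT (zero_lt_one' ℝ))).exists
    exact ⟨t, h0, h1, ht⟩

/-- An edge on the boundary of a region is continued at each of its endpoints. -/
lemma exists_bounds_ne {e : V × V} (he : e ∈ D.edges) {X : Set ℂ} (hb : D.Bounds X e) {v : V}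
    (hv : Inc v e) : ∃ f ∈ D.edges, f ≠ e ∧ D.Bounds X f ∧ Inc v f := by
  by_contra! hcon
  obtain ⟨δ, hδ, hδ1, hδ2⟩ := exists_ball D v
  have hne := sub_ne_zero_of_mem he
  obtain ⟨t, h0, h1, hball⟩ := exists_point_near (D := D) hv hδ
  obtain ⟨c, hc, hcp, hcn, hoe⟩ : ∃ c : ℂ, c ≠ 0 ∧
      (∀ ε : ℝ, 0 < ε → (D.point e (t + Complex.I * ε) - D.pos v) / c ∈ Complex.slitPlane) ∧
      (∀ ε : ℝ, 0 < ε → (D.point e (t + -Complex.I * ε) - D.pos v) / c ∈ Complex.slitPlane) ∧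
      ∀ q ∈ D.openArc e, (q - D.pos v) / c ∉ Complex.slitPlane := by
    rcases hv with rfl | rfl
    · have hco : ∀ q, (q - D.pos e.1) / -(D.pos e.2 - D.pos e.1) = -D.coord e q := fun q => by
        rw [coord, div_neg]
      refine ⟨-(D.pos e.2 - D.pos e.1), neg_ne_zero.2 hne, ?_, ?_, ?_⟩
      · intro ε hε
        rw [hco, coord_point he]
        exact Or.inr (by simpa using hε.ne')
      · intro ε hε
        rw [hco, coord_point he]
        exact Or.inr (by simpa using hε.ne')
      · rintro q ⟨hi, hr, -⟩
        rw [hco, Complex.mem_slitPlane_iff]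
        simp [hi, hr.le]
    · have hco : ∀ q, (q - D.pos e.2) / (D.pos e.2 - D.pos e.1) = D.coord e q - 1 := fun q => by
        rw [coord]
        field_simp
        ring
      refine ⟨D.pos e.2 - D.pos e.1, hne, ?_, ?_, ?_⟩
      · intro ε hε
        rw [hco, coord_point he]
        exact Or.inr (by simpa using hε.ne')
      · intro ε hε
        rw [hco, coord_point he]
        exact Or.inr (by simpa using hε.ne')
      · rintro q ⟨hi, -, hr⟩
        rw [hco, Complex.mem_slitPlane_iff]
        simp [hi, hr.le]
  have hev : ∀ s : ℂ, ∀ᶠ ε : ℝ in nhdsWithin 0 (Ioi 0),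
      D.point e (t + s * ε) ∈ Metric.ball (D.pos v) δ := fun s =>
    (tendsto_point_add e t s).eventually (Metric.isOpen_ball.mem_nhds hball)
  refine not_bounds_of_isPreconnected he (X := X) (isPreconnected_slit (x := D.pos v) hc δ)
    ?_ ?_ h0 h1 ?_ ?_ hb
  · have hpos : ∀ f ∈ D.edges, ∀ w, Inc w f →
        D.pos w ∉ {q ∈ Metric.ball (D.pos v) δ | (q - D.pos v) / c ∈ Complex.slitPlane} := by
      rintro f hf w hw ⟨h, hs⟩
      by_cases hwv : w = v
      · subst hwv
        simp at hs
      · exact hδ2 f hf w hw hwv h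
    exact fun f hf => ⟨hpos f hf _ (Or.inl rfl), hpos f hf _ (Or.inr rfl)⟩
  · rintro f hf ⟨q, hqf, hqb, hqs⟩ hbf
    by_cases hfe : f = e
    · subst hfe
      exact hoe q hqf hqs
    by_cases hvf : Inc v f
    · exact hcon f hf hfe hbf hvf
    · exact Set.disjoint_left.1 (hδ1 f hf hvf) hqb (openArc_subset_arc hf hqf)
  · filter_upwards [hev Complex.I, self_mem_nhdsWithin] with ε h2 h3 using ⟨h2, hcp ε h3⟩
  · filter_upwards [hev (-Complex.I), self_mem_nhdsWithin] with ε h2 h3 using ⟨h2, hcn ε h3⟩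

/-- At a vertex in the closure of a region, either some edge bounds that region, or all the edges
have that region on both sides. -/
lemma bounds_or_sides_eq {v : V} {X F : Set ℂ} (hF : ∀ q ∈ F, q ∉ D.carrier ∧ D.region q = X)
    (hv : D.pos v ∈ closure F) {e : V × V} (he : e ∈ D.edges) (hve : Inc v e) :
    (∃ f ∈ D.edges, D.Bounds X f ∧ Inc v f) ∨ (D.left e = X ∧ D.right e = X) := by
  by_contra! hcon
  obtain ⟨δ, hδ, hδ1, hδ2⟩ := exists_ball D v
  obtain ⟨q, hqb, hqF⟩ := mem_closure_iff_nhds.1 hv _ (Metric.ball_mem_nhds _ hδ)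
  have hvc : D.pos v ∈ D.carrier := by
    refine arc_subset_carrier he ?_
    rcases hve with rfl | rfl
    · exact left_mem_segment ..
    · exact right_mem_segment ..
  have hqv : q ≠ D.pos v := fun h => (hF q hqF).1 (h ▸ hvc)
  obtain ⟨t, h0, h1, hpb⟩ := exists_point_near (D := D) hve hδ
  set p := D.point e t
  have hp : p ∈ D.openArc e := point_mem_openArc he h0 h1
  have hpv : p ≠ D.pos v := fun h => pos_notMem_openArc he v (h ▸ hp)
  have hnear := near_of_isPreconnected (D := D) (X := X) (isPreconnected_punctured (D.pos v) δ)
    ?_ ?_ ⟨hqb, hqv⟩ (Or.inl (hF q hqF)) ⟨hpb, hpv⟩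
  · have := sides_eq_of_near he hnear hp
    exact hcon.2 this.1 this.2
  · have hpos : ∀ f ∈ D.edges, ∀ w, Inc w f → D.pos w ∉ Metric.ball (D.pos v) δ \ {D.pos v} := by
      rintro f hf w hw ⟨h, hs⟩
      exact hδ2 f hf w hw (fun h' => hs (by rw [h']; rfl)) h
    exact fun f hf => ⟨hpos f hf _ (Or.inl rfl), hpos f hf _ (Or.inr rfl)⟩
  · rintro f hf ⟨x, hxf, hxb, -⟩
    by_cases hvf : Inc v f
    · by_contra hbf
      exact hcon.1 f hf hbf hvf
    · exact (Set.disjoint_left.1 (hδ1 f hf hvf) hxb (openArc_subset_arc hf hxf)).elim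

/-- A region which is not the whole complement of the drawing is bounded by some edge. -/
lemma exists_bounds {x y : ℂ} (hx : x ∉ D.carrier) (hy : y ∉ D.carrier)
    (hxy : D.region x ≠ D.region y) : ∃ e ∈ D.edges, D.Bounds (D.region x) e := by
  by_contra! hcon
  set W : Set ℂ := ⋃ e ∈ D.edges, {D.pos e.1, D.pos e.2}
  have hW : W.Finite := D.edges.finite_toSet.biUnion fun e _ => Set.toFinite _
  have hWD : W ⊆ D.carrier := by
    intro q hq
    simp only [W, mem_iUnion] at hq
    obtain ⟨e, he, rfl | rfl⟩ := hq
    · exact arc_subset_carrier he (left_mem_segment ..)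
    · exact arc_subset_carrier he (right_mem_segment ..)
  have hU : IsPreconnected Wᶜ :=
    (hW.countable.isConnected_compl_of_one_lt_rank
      (by rw [Complex.rank_real_complex]; norm_num)).isPreconnected
  refine hxy (region_eq_of_near (near_of_isPreconnected hU ?_ ?_ (fun h => hx (hWD h))
    (Or.inl ⟨hx, rfl⟩) (fun h => hy (hWD h))) hy).symm
  · intro e he
    refine ⟨fun h => h ?_, fun h => h ?_⟩
    · exact mem_biUnion (show e ∈ (D.edges : Set _) from he) (by simp)
    · exact mem_biUnion (show e ∈ (D.edges : Set _) from he) (by simp)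
  · exact fun e he _ => not_not.1 (hcon e he)

lemma side_eq_of_mem_closure {X F : Set ℂ} (hF : ∀ q ∈ F, q ∉ D.carrier ∧ D.region q = X)
    {e : V × V} (he : e ∈ D.edges) (h : D.arc e ⊆ closure F) : D.left e = X ∨ D.right e = X := by
  have hm : D.point e ((1 / 2 : ℝ) : ℂ) ∈ D.openArc e :=
    point_mem_openArc he (by norm_num) (by norm_num)
  obtain ⟨q, hqF, hs, ho⟩ :=
    ((mem_closure_iff_frequently.1 (h (openArc_subset_arc he hm))).and_eventually
      ((eventually_sides he hm).and (eventually_openArc hm))).exists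
  have hq := hF q hqF
  rcases lt_trichotomy (D.coord e q).im 0 with h | h | h
  · exact Or.inr ((hs.2 h).2.symm.trans hq.2)
  · exact (hq.1 (arc_subset_carrier he (openArc_subset_arc he (ho h)))).elim
  · exact Or.inl ((hs.1 h).2.symm.trans hq.2)

/-- The quotient whose argument is the angle under which `e` is seen from `q`. -/
noncomputable def quot (D : LineDrawing V) (e : V × V) (q : ℂ) : ℂ :=
  (D.pos e.2 - q) / (D.pos e.1 - q)

/-- The total angle, weighted by `z`, under which the edges are seen from `q`. -/
noncomputable def winding (D : LineDrawing V) (z : D.edges → ℂ) (q : ℂ) : ℂ :=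
  ∑ e, z e * Complex.log (D.quot e q)

lemma quot_eq {e : V × V} (he : e ∈ D.edges) (q : ℂ) :
    D.quot e q = (D.coord e q - 1) / D.coord e q := by
  have h := sub_ne_zero_of_mem he
  rw [quot, coord, div_sub_one h, div_div_div_cancel_right₀ h, ← neg_div_neg_eq]
  congr 1 <;> ring

lemma quot_mem_slitPlane {e : V × V} (he : e ∈ D.edges) {q : ℂ} (hq : q ∉ D.arc e) :
    D.quot e q ∈ Complex.slitPlane := by
  by_contra h
  rw [Complex.mem_slitPlane_iff] at h
  push Not at h
  set s := (D.quot e q).re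
  have hs : ((s : ℝ) : ℂ) = D.quot e q := Complex.ext (by simp [s]) (by simp [h.2])
  have hs1 : (1 - s : ℂ) ≠ 0 := by
    have : (1 - s : ℝ) ≠ 0 := by linarith [h.1]
    exact_mod_cast this
  have hc0 : D.coord e q ≠ 0 := fun h0 => hq ((mem_arc_iff he).2 (by simp [h0]))
  have hc : D.coord e q = ((1 / (1 - s) : ℝ) : ℂ) := by
    rw [quot_eq he, eq_div_iff hc0] at hs
    push_cast
    rw [eq_div_iff hs1]
    linear_combination -hs
  refine hq ((mem_arc_iff he).2 ?_)
  rw [hc]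
  refine ⟨Complex.ofReal_im _, ?_, ?_⟩
  · rw [Complex.ofReal_re]
    exact div_nonneg zero_le_one (by linarith [h.1])
  · rw [Complex.ofReal_re, div_le_one (by linarith [h.1])]
    linarith [h.1]

lemma hasDerivAt_log_quot {e : V × V} (he : e ∈ D.edges) {q : ℂ} (hq : q ∉ D.arc e) :
    HasDerivAt (fun x => Complex.log (D.quot e x))
      ((D.pos e.1 - q)⁻¹ - (D.pos e.2 - q)⁻¹) q := by
  have h1 : D.pos e.1 - q ≠ 0 := sub_ne_zero.2 fun h => hq (h ▸ left_mem_segment ..)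
  have h2 : D.pos e.2 - q ≠ 0 := sub_ne_zero.2 fun h => hq (h ▸ right_mem_segment ..)
  have hd : HasDerivAt (D.quot e) ((-1 * (D.pos e.1 - q) - (D.pos e.2 - q) * -1) /
      (D.pos e.1 - q) ^ 2) q :=
    ((hasDerivAt_id q).const_sub _).div ((hasDerivAt_id q).const_sub _) h1
  convert hd.clog (quot_mem_slitPlane he hq) using 1
  rw [quot]
  field_simp
  ring

lemma tendsto_winding_cobounded (z : D.edges → ℂ) :
    Filter.Tendsto (D.winding z) (Bornology.cobounded ℂ) (nhds 0) := by
  have h : ∀ e : V × V, Filter.Tendsto (D.quot e) (Bornology.cobounded ℂ) (nhds 1) := by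
    intro e
    have h1 : Filter.Tendsto (fun q => (D.pos e.1 - q)⁻¹) (Bornology.cobounded ℂ) (nhds 0) :=
      Filter.tendsto_inv₀_cobounded.comp (tendsto_const_sub_cobounded _)
    have h2 : Filter.Tendsto (fun q => (D.pos e.2 - D.pos e.1) * (D.pos e.1 - q)⁻¹ + 1)
        (Bornology.cobounded ℂ) (nhds 1) := by
      simpa using (h1.const_mul (D.pos e.2 - D.pos e.1)).add_const 1
    refine h2.congr' ?_
    filter_upwards [Bornology.isBounded_def.1
      (Bornology.isBounded_singleton (x := D.pos e.1))] with q hq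
    have : D.pos e.1 - q ≠ 0 := sub_ne_zero.2 fun h => hq h.symm
    rw [quot]
    field_simp
    ring
  have h0 : ∀ e : D.edges, Filter.Tendsto (fun q => z e * Complex.log (D.quot e q))
      (Bornology.cobounded ℂ) (nhds 0) := by
    intro e
    have := ((continuousAt_clog Complex.one_mem_slitPlane).tendsto.comp (h e)).const_mul
      (z e)
    simpa using this
  have h := tendsto_finsetSum Finset.univ fun e _ => h0 e
  rw [Finset.sum_const_zero] at h
  exact h

variable [DecidableEq V]

/-- The vertices of a drawing that lie on some edge. -/
def verts (D : LineDrawing V) : Finset V := D.edges.image Prod.fst ∪ D.edges.image Prod.snd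

lemma mem_verts {v : V} : v ∈ D.verts ↔ ∃ e ∈ D.edges, Inc v e := by
  simp only [verts, Finset.mem_union, Finset.mem_image, Inc]
  grind

/-- The net flow of `z` out of the vertex `v`. -/
noncomputable def flow (D : LineDrawing V) (z : D.edges → ℂ) (v : V) : ℂ :=
  ∑ e : D.edges, z e * ((if e.1.1 = v then 1 else 0) - if e.1.2 = v then 1 else 0)

lemma sum_flow_mul (z : D.edges → ℂ) (g : V → ℂ) :
    ∑ v ∈ D.verts, D.flow z v * g v = ∑ e, z e * (g e.1.1 - g e.1.2) := by
  simp only [flow, Finset.sum_mul]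
  rw [Finset.sum_comm]
  refine Finset.sum_congr rfl fun e _ => ?_
  have h1 : e.1.1 ∈ D.verts := mem_verts.2 ⟨e.1, e.2, Or.inl rfl⟩
  have h2 : e.1.2 ∈ D.verts := mem_verts.2 ⟨e.1, e.2, Or.inr rfl⟩
  simp only [mul_assoc, ← Finset.mul_sum, sub_mul, ite_mul, one_mul, zero_mul,
    Finset.sum_sub_distrib, Finset.sum_ite_eq, h1, h2, if_true]

lemma hasDerivAt_winding {z : D.edges → ℂ} (hz : ∀ v ∈ D.verts, D.flow z v = 0) {q : ℂ}
    (hq : q ∉ D.carrier) : HasDerivAt (D.winding z) 0 q := by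
  have h : HasDerivAt (D.winding z)
      (∑ e : D.edges, z e * ((D.pos e.1.1 - q)⁻¹ - (D.pos e.1.2 - q)⁻¹)) q := by
    refine HasDerivAt.fun_sum fun e _ => ?_
    exact (hasDerivAt_log_quot e.2 fun h => hq (arc_subset_carrier e.2 h)).const_mul _
  rw [← sum_flow_mul z fun v => (D.pos v - q)⁻¹] at h
  rwa [Finset.sum_eq_zero fun v hv => by rw [hz v hv, zero_mul]] at h

lemma winding_eq {z : D.edges → ℂ} (hz : ∀ v ∈ D.verts, D.flow z v = 0) {x y : ℂ}
    (hx : x ∉ D.carrier) (hy : y ∈ D.region x) : D.winding z y = D.winding z x := by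
  have hsub : D.region x ⊆ D.carrierᶜ := connectedComponentIn_subset _ _
  refine isClosed_carrier.isOpen_compl.connectedComponentIn.is_const_of_deriv_eq_zero
    isPreconnected_connectedComponentIn (fun q hq => ?_) (fun q hq => ?_) hy
    (mem_connectedComponentIn hx)
  · exact (hasDerivAt_winding hz (hsub hq)).differentiableAt.differentiableWithinAt
  · exact (hasDerivAt_winding hz (hsub hq)).deriv

lemma winding_eq_zero_of_unbounded {z : D.edges → ℂ} (hz : ∀ v ∈ D.verts, D.flow z v = 0) {x : ℂ}
    (hx : x ∉ D.carrier) (hb : ¬ Bornology.IsBounded (D.region x)) : D.winding z x = 0 := by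
  have hf : ∃ᶠ q in Bornology.cobounded ℂ, D.winding z q = D.winding z x := by
    intro h
    refine hb ?_
    rw [Bornology.isBounded_def]
    filter_upwards [h] with q hq hq'
    exact hq (winding_eq hz hx hq')
  exact (tendsto_nhds_unique_of_frequently_eq (tendsto_winding_cobounded z)
    tendsto_const_nhds hf).symm

/-- If both sides of `e` have winding zero, then `e` has weight zero, because the winding jumps by a
nonzero multiple of `z e` across `e`. -/
lemma eq_zero_of_winding_eq_zero {z : D.edges → ℂ} (e : D.edges)
    (hl : ∀ q ∉ D.carrier, D.region q = D.left e → D.winding z q = 0)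
    (hr : ∀ q ∉ D.carrier, D.region q = D.right e → D.winding z q = 0) : z e = 0 := by
  have hm : D.point e ((1 / 2 : ℝ) : ℂ) ∈ D.openArc e :=
    point_mem_openArc e.2 (by norm_num) (by norm_num)
  set l := nhdsWithin (0 : ℝ) (Ioi 0)
  set P : ℂ → ℝ → ℂ := fun s ε => D.point e ((1 / 2 : ℝ) + s * ε)
  have hP : ∀ s, Filter.Tendsto (P s) l (nhds (D.point e ((1 / 2 : ℝ) : ℂ))) :=
    fun s => tendsto_point_add e.1 _ s
  have hcont : ∀ f : D.edges, f ≠ e → ∀ s, Filter.Tendsto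
      (fun ε => z f * Complex.log (D.quot f (P s ε))) l
      (nhds (z f * Complex.log (D.quot f (D.point e ((1 / 2 : ℝ) : ℂ))))) := by
    intro f hf s
    have hnot : D.point e ((1 / 2 : ℝ) : ℂ) ∉ D.arc f := fun h =>
      hf (Subtype.ext (eq_of_mem_openArc_of_mem_arc e.2 f.2 hm h).symm)
    exact ((hasDerivAt_log_quot f.2 hnot).continuousAt.tendsto.comp (hP s)).const_mul _
  have hq : ∀ s : ℂ, Filter.Tendsto
      (fun ε : ℝ => (((1 / 2 : ℝ) + s * ε - 1) / ((1 / 2 : ℝ) + s * ε) : ℂ)) l (nhds (-1)) := by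
    intro s
    have h : ContinuousAt
        (fun ε : ℝ => (((1 / 2 : ℝ) + s * ε - 1) / ((1 / 2 : ℝ) + s * ε) : ℂ)) 0 :=
      ContinuousAt.div (by fun_prop) (by fun_prop) (by norm_num)
    have h' := h.tendsto.mono_left (nhdsWithin_le_nhds (s := Ioi 0))
    convert h' using 2
    norm_num
  have hdiv : ∀ (s ε : ℝ), ((((1 / 2 : ℝ) + s * Complex.I * ε - 1) /
      ((1 / 2 : ℝ) + s * Complex.I * ε) : ℂ)).im = s * ε / (1 / 4 + (s * ε) ^ 2) := by
    intro s ε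
    have h : ((1 / 2 : ℝ) ^ 2 + (s * ε) ^ 2) ≠ 0 := by positivity
    simp only [Complex.div_im, Complex.normSq_apply]
    simp
    field_simp
    ring
  have hpos : Filter.Tendsto (fun ε => Complex.log (D.quot e (P Complex.I ε))) l
      (nhds (Real.pi * Complex.I)) := by
    have h := (Complex.tendsto_log_nhdsWithin_im_nonneg_of_re_neg_of_im_zero
      (z := -1) (by simp) (by simp)).comp (tendsto_nhdsWithin_iff.2 ⟨hq Complex.I, by
        filter_upwards [self_mem_nhdsWithin] with ε hε
        have := hdiv 1 ε
        simp only [Complex.ofReal_one, one_mul] at this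
        have hε' : (0 : ℝ) < ε := hε
        change 0 ≤ Complex.im _
        rw [this]
        positivity⟩)
    simpa [quot_eq e.2, P, coord_point e.2, Function.comp_def] using h
  have hneg : Filter.Tendsto (fun ε => Complex.log (D.quot e (P (-Complex.I) ε))) l
      (nhds (-(Real.pi * Complex.I))) := by
    have h := (Complex.tendsto_log_nhdsWithin_im_neg_of_re_neg_of_im_zero
      (z := -1) (by simp) (by simp)).comp (tendsto_nhdsWithin_iff.2 ⟨hq (-Complex.I), by
        filter_upwards [self_mem_nhdsWithin] with ε hε
        have := hdiv (-1) ε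
        simp only [Complex.ofReal_neg, Complex.ofReal_one, neg_mul, one_mul] at this
        have hε' : (0 : ℝ) < ε := hε
        change Complex.im _ < 0
        simp only [neg_mul]
        rw [this]
        rw [neg_div, neg_lt_zero]
        positivity⟩)
    simpa [quot_eq e.2, P, coord_point e.2, Function.comp_def] using h
  have hdiff : Filter.Tendsto
      (fun ε => D.winding z (P Complex.I ε) - D.winding z (P (-Complex.I) ε)) l
      (nhds (z e * (Real.pi * Complex.I) - z e * -(Real.pi * Complex.I))) := by
    have hsum : ∀ q, D.winding z q = z e * Complex.log (D.quot e q) +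
        ∑ f ∈ Finset.univ.erase e, z f * Complex.log (D.quot f q) := fun q =>
      (Finset.add_sum_erase _ _ (Finset.mem_univ e)).symm
    have hrest : ∀ s, Filter.Tendsto
        (fun ε => ∑ f ∈ Finset.univ.erase e, z f * Complex.log (D.quot f (P s ε))) l _ :=
      fun s => tendsto_finsetSum _ fun f hf => hcont f (Finset.ne_of_mem_erase hf) s
    have := ((hpos.const_mul (z e)).add (hrest Complex.I)).sub
      ((hneg.const_mul (z e)).add (hrest (-Complex.I)))
    simpa only [hsum, add_sub_add_right_eq_sub] using this
  have hzero : Filter.Tendsto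
      (fun ε => D.winding z (P Complex.I ε) - D.winding z (P (-Complex.I) ε)) l (nhds 0) := by
    refine tendsto_const_nhds.congr' ?_
    filter_upwards [eventually_left e.2 (t := 1 / 2) (by norm_num) (by norm_num),
      eventually_right e.2 (t := 1 / 2) (by norm_num) (by norm_num)] with ε h1 h2
    simp only [P]
    rw [hl _ h1.1 h1.2, hr _ h2.1 h2.2, sub_zero]
  have hfin := tendsto_nhds_unique hdiff hzero
  have h2 : z e * (2 * Real.pi * Complex.I) = 0 := by linear_combination hfin
  rcases mul_eq_zero.1 h2 with h | h
  · exact h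
  · exact (Complex.two_pi_I_ne_zero h).elim

/-- A form of Euler's formula: the regions touching the edges, together with the vertices, bound
the number of edges. -/
lemma card_edges_lt (hne : D.edges.Nonempty) {x : ℂ} (hx : x ∉ D.carrier)
    (hb : ¬ Bornology.IsBounded (D.region x)) (Φ : Finset (Set ℂ))
    (hΦ : ∀ X ∈ Φ, ∃ q ∉ D.carrier, D.region q = X)
    (hside : ∀ e ∈ D.edges, (D.left e = D.region x ∨ D.left e ∈ Φ) ∧
      (D.right e = D.region x ∨ D.right e ∈ Φ)) :
    D.edges.card + 1 ≤ Φ.card + D.verts.card := by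
  choose r hr hrX using hΦ
  obtain ⟨e₀, he₀⟩ := hne
  have hv₀ : e₀.1 ∈ D.verts := mem_verts.2 ⟨e₀, he₀, Or.inl rfl⟩
  let Λ : (D.edges → ℂ) →ₗ[ℂ] ((D.verts.erase e₀.1 → ℂ) × (Φ → ℂ)) :=
    { toFun := fun z => (fun v => D.flow z v, fun X => D.winding z (r X.1 X.2))
      map_add' := fun z w => by
        ext <;> simp [flow, winding, add_mul, Finset.sum_add_distrib]
      map_smul' := fun c z => by
        ext <;> simp [flow, winding, mul_assoc, Finset.mul_sum] }
  have hinj : Function.Injective Λ := by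
    rw [← LinearMap.ker_eq_bot, LinearMap.ker_eq_bot']
    intro z hz
    obtain ⟨hflow, hwind⟩ := Prod.mk.inj hz
    have hflow' : ∀ v ∈ D.verts, D.flow z v = 0 := by
      have h0 : ∀ v ∈ D.verts.erase e₀.1, D.flow z v = 0 := fun v hv => congrFun hflow ⟨v, hv⟩
      have hs := sum_flow_mul z fun _ => (1 : ℂ)
      simp only [mul_one, sub_self, mul_zero, Finset.sum_const_zero] at hs
      rw [← Finset.add_sum_erase _ _ hv₀, Finset.sum_eq_zero h0, add_zero] at hs
      intro v hv
      by_cases h : v = e₀.1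
      · rw [h, hs]
      · exact h0 v (Finset.mem_erase.2 ⟨h, hv⟩)
    have hreg : ∀ q ∉ D.carrier, (D.region q = D.region x ∨ D.region q ∈ Φ) →
        D.winding z q = 0 := by
      rintro q hq (h | h)
      · have hmem : x ∈ D.region x := mem_connectedComponentIn hx
        rw [← h] at hmem
        rw [← winding_eq hflow' hq hmem]
        exact winding_eq_zero_of_unbounded hflow' hx hb
      · have hmem : r _ h ∈ D.region (r _ h) := mem_connectedComponentIn (hr _ h)
        rw [hrX _ h] at hmem
        rw [← winding_eq hflow' hq hmem]
        exact congrFun hwind ⟨_, h⟩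
    funext e
    exact eq_zero_of_winding_eq_zero e (fun q hq h => hreg q hq (h ▸ (hside e e.2).1))
      (fun q hq h => hreg q hq (h ▸ (hside e e.2).2))
  have hrank := LinearMap.finrank_le_finrank_of_injective hinj
  simp only [Module.finrank_prod, Module.finrank_fintype_fun_eq_card, Fintype.card_coe,
    Finset.card_erase_of_mem hv₀] at hrank
  have := Finset.card_pos.2 ⟨_, hv₀⟩
  omega

/-- Adjacency in the underlying graph of a drawing. -/
def Joined (D : LineDrawing V) (u v : V) : Prop := (u, v) ∈ D.edges ∨ (v, u) ∈ D.edges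

/-- In a triangle-free drawing, each region bounded by some edge is bounded by at least four. -/
lemma four_le_card_bounds (hasym : ∀ u v, (u, v) ∈ D.edges → (v, u) ∉ D.edges)
    (htri : ∀ u v w, D.Joined u v → D.Joined v w → ¬ D.Joined w u) {X : Set ℂ}
    {N : Finset (V × V)} (hN : ∀ e, e ∈ N ↔ e ∈ D.edges ∧ D.Bounds X e) (hne : N.Nonempty) :
    4 ≤ N.card := by
  have key : ∀ e ∈ N, ∀ v, Inc v e → ∃ w, v ≠ w ∧ ∃ f ∈ N, f ≠ e ∧ (f = (v, w) ∨ f = (w, v)) := by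
    intro e he v hv
    obtain ⟨f, hf, hfe, hb, hi⟩ := exists_bounds_ne ((hN e).1 he).1 ((hN e).1 he).2 hv
    have hn := D.ne f hf
    rcases hi with rfl | rfl
    · exact ⟨f.2, hn, f, (hN f).2 ⟨hf, hb⟩, hfe, Or.inl rfl⟩
    · exact ⟨f.1, hn.symm, f, (hN f).2 ⟨hf, hb⟩, hfe, Or.inr rfl⟩
  have hsub : ∀ e ∈ N, e ∈ D.edges := fun e he => ((hN e).1 he).1
  obtain ⟨⟨a, b⟩, he⟩ := hne
  have hab : a ≠ b := D.ne _ (hsub _ he)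
  obtain ⟨c, hac, f, hf, hfe, hfc⟩ := key _ he a (Or.inl rfl)
  obtain ⟨d, hbd, g, hg, hge, hgd⟩ := key _ he b (Or.inr rfl)
  have hcf : Inc c f := by rcases hfc with rfl | rfl <;> simp [Inc]
  obtain ⟨w, hcw, h, hh, hhf, hhw⟩ := key _ hf c hcf
  have h1 := hsub _ he
  have h2 := hsub _ hf
  have h3 := hsub _ hg
  have h4 := hsub _ hh
  have hcb : c ≠ b := by
    rintro rfl
    rcases hfc with rfl | rfl
    · exact hfe rfl
    · exact hasym _ _ h1 h2
  have hda : d ≠ a := by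
    rintro rfl
    rcases hgd with rfl | rfl
    · exact hasym _ _ h1 h3
    · exact hge rfl
  have hcd : c ≠ d := by
    rintro rfl
    refine htri a b c (Or.inl h1) ?_ ?_
    · rcases hgd with rfl | rfl
      exacts [Or.inl h3, Or.inr h3]
    · rcases hfc with rfl | rfl
      exacts [Or.inr h2, Or.inl h2]
  have hfg : f ≠ g := by grind
  have hhe : h ≠ (a, b) := by grind
  have hhg : h ≠ g := by grind
  have hcard : ({(a, b), f, g, h} : Finset (V × V)).card = 4 := by
    rw [Finset.card_insert_of_notMem, Finset.card_insert_of_notMem,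
      Finset.card_insert_of_notMem, Finset.card_singleton] <;> simp [*, Ne.symm, hhf.symm, hhg.symm]
  rw [← hcard]
  refine Finset.card_le_card fun x hx => ?_
  simp only [Finset.mem_insert, Finset.mem_singleton] at hx
  rcases hx with rfl | rfl | rfl | rfl <;> assumption

open Classical in
/-- The number of sides of the edge `e` that lie in the region `X`. -/
noncomputable def sideCount (D : LineDrawing V) (X : Set ℂ) (e : V × V) : ℕ :=
  (if D.left e = X then 1 else 0) + if D.right e = X then 1 else 0

open Classical in
lemma two_le_sum_sideCount {X F : Set ℂ} (hF : ∀ q ∈ F, q ∉ D.carrier ∧ D.region q = X) {v : V}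
    (hv : v ∈ D.verts) (hcl : D.pos v ∈ closure F) :
    2 ≤ ∑ e ∈ D.edges with Inc v e, D.sideCount X e := by
  obtain ⟨e, he, hve⟩ := mem_verts.1 hv
  rcases bounds_or_sides_eq hF hcl he hve with ⟨f, hf, hb, hi⟩ | ⟨hl, hr⟩
  · obtain ⟨g, hg, hgf, hb', hi'⟩ := exists_bounds_ne hf hb hi
    have hsub : ({f, g} : Finset (V × V)) ⊆ {e ∈ D.edges | Inc v e} := by
      intro x hx
      rcases Finset.mem_insert.1 hx with rfl | hx
      · simp [*]
      · simp [Finset.mem_singleton.1 hx, *]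
    have hone : ∀ e, D.Bounds X e → D.sideCount X e = 1 := by
      intro e he
      unfold Bounds at he
      unfold sideCount
      split_ifs <;> tauto
    calc 2 = ∑ e ∈ {f, g}, D.sideCount X e := by
          rw [Finset.sum_pair hgf.symm, hone _ hb, hone _ hb']
      _ ≤ _ := Finset.sum_le_sum_of_subset hsub
  · calc 2 = D.sideCount X e := by simp [sideCount, hl, hr]
      _ ≤ _ := Finset.single_le_sum (fun _ _ => Nat.zero_le _) (by simp [*])

open Classical in
/-- The counting inequality for triangle-free drawings: `S` is an independent set of vertices on
the outer region and `T` a set of outer edges avoiding `S`. -/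
lemma two_mul_card_edges_add_le (hasym : ∀ u v, (u, v) ∈ D.edges → (v, u) ∉ D.edges)
    (htri : ∀ u v w, D.Joined u v → D.Joined v w → ¬ D.Joined w u) (hne : D.edges.Nonempty)
    {x : ℂ} (hx : x ∉ D.carrier) (hb : ¬ Bornology.IsBounded (D.region x)) {F : Set ℂ}
    (hF : ∀ q ∈ F, q ∉ D.carrier ∧ D.region q = D.region x) {S : Finset V} (hS : S ⊆ D.verts)
    (hScl : ∀ v ∈ S, D.pos v ∈ closure F)
    (hSind : ∀ e ∈ D.edges, e.1 ∈ S → e.2 ∉ S) {T : Finset (V × V)} (hT : T ⊆ D.edges)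
    (hTcl : ∀ e ∈ T, D.arc e ⊆ closure F) (hTS : ∀ e ∈ T, e.1 ∉ S ∧ e.2 ∉ S) :
    2 * D.edges.card + 4 + 2 * S.card + T.card ≤ 4 * D.verts.card := by
  set O := D.region x
  set Φ := (D.edges.image D.left ∪ D.edges.image D.right).erase O with hΦ
  have hmem : ∀ X, X ∈ Φ ↔ X ≠ O ∧ ∃ e ∈ D.edges, D.left e = X ∨ D.right e = X := by
    intro X
    simp only [hΦ, Finset.mem_erase, Finset.mem_union, Finset.mem_image]
    grind
  have hreg : ∀ X ∈ Φ, ∃ q ∉ D.carrier, D.region q = X := by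
    intro X hX
    obtain ⟨-, e, he, h | h⟩ := (hmem X).1 hX
    · obtain ⟨ε, h'⟩ := (eventually_left he (t := 1 / 2) (by norm_num) (by norm_num)).exists
      exact ⟨_, h'.1, h'.2.trans h⟩
    · obtain ⟨ε, h'⟩ := (eventually_right he (t := 1 / 2) (by norm_num) (by norm_num)).exists
      exact ⟨_, h'.1, h'.2.trans h⟩
  have heuler := card_edges_lt hne hx hb Φ hreg fun e he => by
    constructor
    · by_cases h : D.left e = O
      exacts [Or.inl h, Or.inr ((hmem _).2 ⟨h, e, he, Or.inl rfl⟩)]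
    · by_cases h : D.right e = O
      exacts [Or.inl h, Or.inr ((hmem _).2 ⟨h, e, he, Or.inr rfl⟩)]
  have hfour : ∀ X ∈ Φ, 4 ≤ ∑ e ∈ D.edges, D.sideCount X e := by
    intro X hX
    obtain ⟨q, hq, rfl⟩ := hreg X hX
    obtain ⟨e, he, hbe⟩ := exists_bounds hq hx ((hmem _).1 hX).1
    have h4 := four_le_card_bounds hasym htri (X := D.region q)
      (N := {e ∈ D.edges | D.Bounds (D.region q) e}) (fun e => by simp) ⟨e, by simp [*]⟩
    refine h4.trans ?_
    rw [Finset.card_filter]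
    refine Finset.sum_le_sum fun e _ => ?_
    unfold Bounds sideCount
    split_ifs <;> simp_all
  have htotal : ∑ X ∈ Φ, ∑ e ∈ D.edges, D.sideCount X e + ∑ e ∈ D.edges, D.sideCount O e ≤
      2 * D.edges.card := by
    rw [add_comm, ← Finset.sum_insert (f := fun X => ∑ e ∈ D.edges, D.sideCount X e)
      (Finset.notMem_erase O _), Finset.sum_comm, mul_comm, ← smul_eq_mul, ← Finset.sum_const]
    refine Finset.sum_le_sum fun e _ => ?_
    simp only [sideCount, Finset.sum_add_distrib, Finset.sum_ite_eq]
    split_ifs <;> simp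
  have houter : 2 * S.card + T.card ≤ ∑ e ∈ D.edges, D.sideCount O e := by
    have h1 : 2 * S.card ≤ ∑ v ∈ S, ∑ e ∈ D.edges with Inc v e, D.sideCount O e := by
      rw [mul_comm, ← smul_eq_mul, ← Finset.sum_const]
      exact Finset.sum_le_sum fun v hv => two_le_sum_sideCount hF (hS hv) (hScl v hv)
    have h2 : T.card ≤ ∑ e ∈ D.edges, if e ∈ T then D.sideCount O e else 0 := by
      rw [← Finset.sum_filter, Finset.filter_mem_eq_inter, Finset.inter_eq_right.2 hT,
        Finset.card_eq_sum_ones]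
      refine Finset.sum_le_sum fun e he => ?_
      rcases side_eq_of_mem_closure hF (hT he) (hTcl e he) with h | h <;> simp [sideCount, h]
    simp only [Finset.sum_filter] at h1
    rw [Finset.sum_comm] at h1
    refine (add_le_add h1 h2).trans ?_
    rw [← Finset.sum_add_distrib]
    refine Finset.sum_le_sum fun e he => ?_
    rw [← Finset.sum_filter, Finset.sum_const, smul_eq_mul]
    by_cases heT : e ∈ T
    · have : {v ∈ S | Inc v e} = ∅ := by
        refine Finset.filter_eq_empty_iff.2 ?_
        rintro v hv (rfl | rfl)
        exacts [(hTS e heT).1 hv, (hTS e heT).2 hv]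
      simp [this, heT]
    · have : {v ∈ S | Inc v e}.card ≤ 1 := by
        rw [Finset.card_le_one]
        have := hSind e he
        simp only [Inc]
        grind
      simp only [heT, if_false, add_zero]
      exact (Nat.mul_le_mul_right _ this).trans (one_mul _).le
  have := Finset.sum_le_sum hfour
  rw [Finset.sum_const, smul_eq_mul] at this
  omega

end LineDrawing

/-- The plane `ℝ × ℝ` as `ℂ`. -/
noncomputable abbrev toComplex : (ℝ × ℝ) ≃L[ℝ] ℂ := Complex.equivRealProdCLM.symm

lemma toComplex_seg (x y : ℝ × ℝ) :
    segment ℝ (toComplex x) (toComplex y) = toComplex '' seg x y :=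
  (image_segment ℝ toComplex.toLinearEquiv.toLinearMap.toAffineMap x y).symm

/-- The drawing in `ℂ` of a set of edges of a plane graph. -/
noncomputable def PlaneEmb.toLineDrawing (E : PlaneEmb G) (A : Finset (V × V))
    (hA : ∀ e ∈ A, G.Adj e.1 e.2) (hasym : ∀ u v, (u, v) ∈ A → (v, u) ∉ A) : LineDrawing V where
  pos v := toComplex (E.pos v)
  edges := A
  inj := toComplex.injective.comp E.inj
  ne e he := (hA e he).ne
  meet := by
    rintro ⟨a, b⟩ he ⟨c, d⟩ hf hne
    have hs : s(a, b) ≠ s(c, d) := by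
      rw [Ne, Sym2.eq_iff]
      rintro (⟨rfl, rfl⟩ | ⟨rfl, rfl⟩)
      exacts [hne rfl, hasym _ _ he hf]
    simp only [toComplex_seg]
    rintro _ ⟨⟨x, hx, rfl⟩, y, hy, hxy⟩
    rw [toComplex.injective hxy] at hy
    have := E.edges_meet (hA _ he) (hA _ hf) hs ⟨hx, hy⟩
    simpa using this
  off := by
    rintro ⟨a, b⟩ he v h1 h2
    simp only [toComplex_seg]
    rintro ⟨x, hx, hxv⟩
    rw [toComplex.injective hxv] at hx
    exact E.vertex_off (hA _ he) h1 h2 hx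

/-- The counting inequality for triangle-free plane graphs: `S` is an independent set of vertices
on the outer face and `T` a set of outer edges avoiding `S`. -/
lemma PlaneEmb.two_mul_card_edges_add_le [DecidableEq V] (E : PlaneEmb G)
    (hG : ¬ HasCycleLen G 3) {F : Set (ℝ × ℝ)} (hF : E.IsOuterFace F) {A : Finset (V × V)}
    (hne : A.Nonempty) (hA : ∀ e ∈ A, G.Adj e.1 e.2) (hasym : ∀ u v, (u, v) ∈ A → (v, u) ∉ A)
    {S : Finset V} (hS : S ⊆ A.image Prod.fst ∪ A.image Prod.snd)
    (hSF : ∀ v ∈ S, v ∈ E.onFace F) (hSind : ∀ u ∈ S, ∀ v ∈ S, ¬ G.Adj u v)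
    {T : Finset (V × V)} (hT : T ⊆ A) (hTF : ∀ e ∈ T, E.BoundaryEdge F e.1 e.2)
    (hTS : ∀ e ∈ T, e.1 ∉ S ∧ e.2 ∉ S) :
    2 * A.card + 4 + 2 * S.card + T.card ≤ 4 * (A.image Prod.fst ∪ A.image Prod.snd).card := by
  obtain ⟨⟨q, hq, hFq⟩, hFb⟩ := hF
  set D := E.toLineDrawing A hA hasym
  have hqF : q ∈ F := hFq ▸ mem_connectedComponentIn hq
  have hpre : IsPreconnected F := hFq ▸ isPreconnected_connectedComponentIn
  have hsub : F ⊆ E.drawingᶜ := hFq ▸ connectedComponentIn_subset _ _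
  have hdisj : toComplex '' F ⊆ D.carrierᶜ := by
    rintro _ ⟨y, hy, rfl⟩ hcon
    obtain ⟨e, he, hye⟩ := mem_iUnion₂.1 hcon
    change _ ∈ segment ℝ (toComplex (E.pos e.1)) (toComplex (E.pos e.2)) at hye
    rw [toComplex_seg] at hye
    obtain ⟨z, hz, hzy⟩ := hye
    rw [toComplex.injective hzy] at hz
    refine hsub hy (Or.inr ?_)
    simp only [mem_iUnion]
    exact ⟨e.1, e.2, hA e he, hz⟩
  have hreg : toComplex '' F ⊆ D.region (toComplex q) :=
    (hpre.image _ toComplex.continuous.continuousOn).subset_connectedComponentIn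
      (mem_image_of_mem _ hqF) hdisj
  have hcl : ∀ y ∈ closure F, toComplex y ∈ closure (toComplex '' F) := fun y hy =>
    image_closure_subset_closure_image toComplex.continuous (mem_image_of_mem _ hy)
  have hadj : ∀ u v, D.Joined u v → G.Adj u v := by
    rintro u v (h | h)
    exacts [hA _ h, (hA _ h).symm]
  refine LineDrawing.two_mul_card_edges_add_le (D := D) hasym ?_ hne
    (hdisj (mem_image_of_mem _ hqF)) ?_ (F := toComplex '' F) ?_ hS (fun v hv => hcl _ (hSF v hv))
    (fun e he h1 h2 => hSind _ h1 _ h2 (hA e he)) hT ?_ hTS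
  · intro u v w h1 h2 h3
    refine hG (SimpleGraph.is3Clique_iff_exists_cycle_length_three.1 ⟨{u, v, w}, ?_⟩)
    rw [SimpleGraph.is3Clique_triple_iff]
    exact ⟨hadj _ _ h1, (hadj _ _ h3).symm, hadj _ _ h2⟩
  · intro hb
    refine hFb ?_
    have := (toComplex.symm.lipschitz).isBounded_image (hb.subset hreg)
    rwa [← image_comp, show (toComplex.symm ∘ toComplex : ℝ × ℝ → ℝ × ℝ) = id from
      funext fun x => toComplex.symm_apply_apply x, image_id] at this
  · exact fun y hy => ⟨hdisj hy, (connectedComponentIn_eq (hreg hy)).symm⟩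
  · rintro e he _ hy
    change _ ∈ segment ℝ (toComplex (E.pos e.1)) (toComplex (E.pos e.2)) at hy
    rw [toComplex_seg] at hy
    obtain ⟨y, hy, rfl⟩ := hy
    exact hcl y ((hTF e he).2 hy)

/-- List coloring by orienting the edges whose ends share a color: such an orientation, with fewer
than `|L v|` edges entering each vertex `v`, exists by Hall's theorem. -/
lemma colorableWith_of_card_le [LinearOrder V] [Fintype V] {L : V → Finset ℕ}
    (hL1 : ∀ v, 1 ≤ (L v).card) (hL : ∀ ⦃u v⦄, G.Adj u v → (L u ∩ L v).card ≤ 1)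
    (hH : ∀ A : Finset (V × V), A.Nonempty →
      (∀ e ∈ A, e.1 < e.2 ∧ G.Adj e.1 e.2 ∧ (L e.1 ∩ L e.2).Nonempty) →
      A.card ≤ ∑ v ∈ A.image Prod.fst ∪ A.image Prod.snd, ((L v).card - 1)) :
    ColorableWith G L := by
  classical
  let ι := {e : V × V // e.1 < e.2 ∧ G.Adj e.1 e.2 ∧ (L e.1 ∩ L e.2).Nonempty}
  let t : ι → Finset (Σ _ : V, ℕ) := fun e =>
    ({e.1.1, e.1.2} : Finset V).sigma fun v => Finset.range ((L v).card - 1)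
  obtain ⟨f, hf, hft⟩ : ∃ f : ι → Σ _ : V, ℕ, Function.Injective f ∧ ∀ e, f e ∈ t e := by
    refine (Finset.all_card_le_biUnion_card_iff_exists_injective t).1 fun s => ?_
    rcases s.eq_empty_or_nonempty with rfl | hs
    · simp
    have h := hH (s.image Subtype.val) (hs.image _) fun e he => by
      obtain ⟨x, -, rfl⟩ := Finset.mem_image.1 he
      exact x.2
    rw [Finset.card_image_of_injective _ Subtype.val_injective] at h
    refine h.trans ?_
    rw [← Finset.sum_congr rfl fun v _ => Finset.card_range ((L v).card - 1), ← Finset.card_sigma]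
    refine Finset.card_le_card ?_
    rintro ⟨v, i⟩ hv
    simp only [Finset.mem_sigma, Finset.mem_union, Finset.mem_image, Finset.mem_biUnion, t,
      Finset.mem_insert, Finset.mem_singleton] at hv ⊢
    obtain ⟨⟨_, ⟨e, he, rfl⟩, rfl⟩ | ⟨_, ⟨e, he, rfl⟩, rfl⟩, hi⟩ := hv
    exacts [⟨e, he, Or.inl rfl, hi⟩, ⟨e, he, Or.inr rfl, hi⟩]
  have hcol : ∀ v, ∃ c ∈ L v, ∀ e : ι, (f e).1 = v → c ∉ L e.1.1 ∩ L e.1.2 := by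
    intro v
    by_contra! hcon
    set I : Finset ι := {e | (f e).1 = v}
    have h1 : L v ⊆ I.biUnion fun e => L e.1.1 ∩ L e.1.2 := by
      intro c hc
      obtain ⟨e, he, hce⟩ := hcon c hc
      exact Finset.mem_biUnion.2 ⟨e, by simp [I, he], hce⟩
    have h2 : I.card ≤ (L v).card - 1 := by
      rw [← Finset.card_range ((L v).card - 1)]
      refine Finset.card_le_card_of_injOn (fun e => (f e).2) (fun e he => ?_) ?_
      · have hev : (f e).1 = v := by simpa [I] using he
        have := (Finset.mem_sigma.1 (hft e)).2
        rwa [hev] at this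
      · intro e he e' he' h
        have hev : (f e).1 = v := by simpa [I] using he
        have hev' : (f e').1 = v := by simpa [I] using he'
        exact hf (Sigma.ext (hev.trans hev'.symm) (heq_of_eq h))
    have h3 := (Finset.card_le_card h1).trans
      (Finset.card_biUnion_le_card_mul I _ 1 fun e _ => hL e.2.2.1)
    have := hL1 v
    omega
  choose φ hφ hφ' using hcol
  have hlt : ∀ u v, u < v → G.Adj u v → φ u ≠ φ v := by
    intro u v huv hadj heq
    have hmem : φ u ∈ L u ∩ L v := Finset.mem_inter.2 ⟨hφ u, heq ▸ hφ v⟩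
    let e : ι := ⟨(u, v), huv, hadj, _, hmem⟩
    have he := (Finset.mem_sigma.1 (hft e)).1
    rcases Finset.mem_insert.1 he with h | h
    · exact hφ' u e h hmem
    · exact hφ' v e (Finset.mem_singleton.1 h) (heq ▸ hmem)
  refine ⟨φ, hφ, fun u v hadj => ?_⟩
  rcases lt_or_gt_of_ne hadj.ne with h | h
  exacts [hlt u v h hadj, (hlt v u h hadj.symm).symm]

lemma PlaneEmb.BoundaryEdge.symm {E : PlaneEmb G} {F : Set (ℝ × ℝ)} {u v : V}
    (h : E.BoundaryEdge F u v) : E.BoundaryEdge F v u :=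
  ⟨h.1.symm, by rw [seg, segment_symm]; exact h.2⟩

/-- Every triangle-free plane graph with lists as in `Cfg3.Valid` can be colored. -/
lemma Cfg3.Valid.colorable {C : Cfg3} (hC : C.Valid) : C.Colorable := by
  obtain ⟨htri, hF, hnd, hlen, hPF, hchain, hL1, hL, h3, h2, hP1, hind, ψ, hψ, hψ'⟩ := hC
  refine colorableWith_of_card_le hL1 hL fun A hne hA => ?_
  set W := A.image Prod.fst ∪ A.image Prod.snd with hW
  set S := W.filter fun v => (C.L v).card = 2
  set Q := W.filter fun v => v ∈ C.P
  have hAadj : ∀ e ∈ A, C.G.Adj e.1 e.2 := fun e he => (hA e he).2.1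
  have hSF : ∀ v ∈ S, v ∈ C.E.onFace C.F := by
    intro v hv
    by_contra h
    have := h3 v h
    have := (Finset.mem_filter.1 hv).2
    omega
  have hSind : ∀ u ∈ S, ∀ v ∈ S, ¬ C.G.Adj u v := fun u hu v hv h =>
    hind h (Finset.mem_filter.1 hu).2 (Finset.mem_filter.1 hv).2
  have hsum : 2 * W.card ≤ ∑ v ∈ W, ((C.L v).card - 1) + S.card + 2 * Q.card := by
    simp only [S, Q, Finset.card_filter, Finset.mul_sum, ← Finset.sum_add_distrib]
    rw [mul_comm, ← smul_eq_mul, ← Finset.sum_const]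
    refine Finset.sum_le_sum fun v _ => ?_
    by_cases hvP : v ∈ C.P
    · simp [hvP]
    · have h2' : 2 ≤ (C.L v).card := by
        by_cases hv : v ∈ C.E.onFace C.F
        exacts [h2 v hv hvP, (Nat.le_succ 2).trans (h3 v hv)]
      split_ifs <;> omega
  by_cases hQ : Q.card ≤ 1
  · have := C.E.two_mul_card_edges_add_le htri hF hne hAadj
      (fun u v h h' => lt_asymm (hA _ h).1 (hA _ h').1) (S := S) (Finset.filter_subset _ _) hSF
      hSind (Finset.empty_subset A) (by simp) (by simp)
    rw [← hW] at this
    omega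
  · push Not at hQ
    obtain ⟨a, ha, b, hb, hab⟩ := Finset.one_lt_card.1 hQ
    have haP := (Finset.mem_filter.1 ha).2
    have hbP := (Finset.mem_filter.1 hb).2
    have hQ2 : Q.card ≤ 2 := by
      refine (Finset.card_le_card fun v hv => ?_).trans (C.P.toFinset_card_le.trans hlen)
      exact List.mem_toFinset.2 (Finset.mem_filter.1 hv).2
    have hbd : C.E.BoundaryEdge C.F a b := by
      clear_value Q
      generalize C.P = P at *
      match P, hlen with
      | [], _ => simp at haP
      | [x], _ => simp_all
      | [x, y], _ =>
        have hxy : C.E.BoundaryEdge C.F x y := (List.isChain_cons_cons.1 hchain).1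
        simp only [List.mem_cons, List.not_mem_nil, or_false] at haP hbP
        rcases haP with rfl | rfl <;> rcases hbP with rfl | rfl
        exacts [(hab rfl).elim, hxy, hxy.symm, (hab rfl).elim]
    obtain ⟨p, hp, hpb, hpP, hpW⟩ : ∃ p : Fin C.n × Fin C.n, p.1 < p.2 ∧
        C.E.BoundaryEdge C.F p.1 p.2 ∧ (p.1 ∈ C.P ∧ p.2 ∈ C.P) ∧ p.1 ∈ W ∧ p.2 ∈ W := by
      have haW := (Finset.mem_filter.1 ha).1
      have hbW := (Finset.mem_filter.1 hb).1
      rcases lt_or_gt_of_ne hab with h | h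
      exacts [⟨(a, b), h, hbd, ⟨haP, hbP⟩, haW, hbW⟩, ⟨(b, a), h, hbd.symm, ⟨hbP, haP⟩, hbW, haW⟩]
    have hpA : p ∉ A := by
      intro hpA
      obtain ⟨c, hc⟩ := (hA p hpA).2.2
      have hc1 := Finset.card_le_one.1 (hP1 _ hpP.1).le _ (Finset.mem_inter.1 hc).1 _ (hψ _ hpP.1)
      have hc2 := Finset.card_le_one.1 (hP1 _ hpP.2).le _ (Finset.mem_inter.1 hc).2 _ (hψ _ hpP.2)
      exact hψ' hpP.1 hpP.2 hpb.1 (hc1.symm.trans hc2)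
    have hW' : (insert p A).image Prod.fst ∪ (insert p A).image Prod.snd = W := by
      rw [Finset.image_insert, Finset.image_insert, Finset.insert_union, Finset.union_insert,
        ← hW, Finset.insert_eq_of_mem hpW.2, Finset.insert_eq_of_mem hpW.1]
    have hlt : ∀ e ∈ insert p A, e.1 < e.2 := by
      intro e he
      rcases Finset.mem_insert.1 he with rfl | he
      exacts [hp, (hA e he).1]
    have hPS : ∀ v ∈ C.P, v ∉ S := by
      intro v hv hvS
      have := hP1 v hv
      have := (Finset.mem_filter.1 hvS).2
      omega
    have := C.E.two_mul_card_edges_add_le htri hF (A := insert p A) (Finset.insert_nonempty _ _)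
      (fun e he => by
        rcases Finset.mem_insert.1 he with rfl | he
        exacts [hpb.1, hAadj e he])
      (fun u v h h' => lt_asymm (hlt _ h) (hlt _ h')) (S := S)
      (hW' ▸ Finset.filter_subset _ _) hSF hSind (T := {p})
      (by simp) (by simpa using hpb) (by simpa using ⟨hPS _ hpP.1, hPS _ hpP.2⟩)
    rw [hW', Finset.card_insert_of_notMem hpA, Finset.card_singleton] at this
    omega

/-- **Claim 2 in the proof of Theorem 5.** A minimum counterexample to Theorem 5 has a
good vertex: an `L3`-vertex of the outer face lying on no bad 2-chord. -/
theorem min_cex_triangleFree_good_vertex (C : Cfg3) (hC : C.MinCounterexample) :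
    ∃ x : Fin C.n, C.IsGoodVertex x := by
  exact (hC.2.1 hC.1.colorable).elim

end ChoosSep
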